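/- arXiv:math/0306043 — 2 statements merged into one kernel-verified Lean document; each statement's English description precedes it below -/
import Mathlib

section
/- Let A be a semiprimary ring and suppose that for every simple A-module S there exists m(S) such that Ext_A^n(S, S) = 0 for all n ≥ m(S). Define, for simple modules S and T: S ⪯ T if and only if S is a direct summand of Ω^m T for some m ≥ 0 (where Ω denotes the syzygy in a minimal projective resolution). Then ⪯ is a partial order (in particular antisymmetric) on the set of isomorphism classes of simple A-modules. -/
open CategoryTheory

noncomputable section

instance (A : Type) [Ring A] : HasExt.{1} (ModuleCat.{0} A) := by
  letI := HasDerivedCategory.standard (ModuleCat.{0} A)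
  exact hasExt_of_hasDerivedCategory _

/-- The Jacobson radical of the ring `A`, as a two-sided ideal. -/
def jrad (A : Type) [Ring A] : TwoSidedIdeal A := TwoSidedIdeal.jacobson ⊥

/-- `A/J` is a semisimple ring. -/
def SemisimpleModJ (A : Type) [Ring A] : Prop :=
  IsSemisimpleRing (jrad A).ringCon.Quotient

/-- The Jacobson radical satisfies `J ^ 3 = 0`. -/
def JCubeZero (A : Type) [Ring A] : Prop :=
  ∀ x y z : A, x ∈ jrad A → y ∈ jrad A → z ∈ jrad A → x * y * z = 0

/-- `A` is semiprimary: `A/J` is semisimple and the Jacobson radical `J` is nilpotent. -/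
def IsSemiprimary (A : Type) [Ring A] : Prop :=
  SemisimpleModJ A ∧
    ∃ n : ℕ, ∀ x : Fin n → A, (∀ i, x i ∈ jrad A) → (List.ofFn x).prod = 0

/-- `A/J` as a left `A`-module, an object of `ModuleCat A`. -/
def AmodJ (A : Type) [Ring A] : ModuleCat.{0} A :=
  ModuleCat.of A (A ⧸ (jrad A).asIdeal)

/-- The submodule `J·N`, for `J` the Jacobson radical of `A` and `N` a submodule of `M`. -/
def jSmul (A : Type) [Ring A] {M : Type} [AddCommGroup M] [Module A M]
    (N : Submodule A M) : Submodule A M :=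
  Submodule.span A {y | ∃ x ∈ jrad A, ∃ m ∈ N, y = x • m}

/-- `M` has projective dimension at most `n`, characterized by vanishing of
`Ext^k(M, -)` for `k > n`. -/
def projDimLE (A : Type) [Ring A] (M : ModuleCat.{0} A) (n : ℕ) : Prop :=
  ∀ (N : ModuleCat.{0} A) (k : ℕ), n < k → Subsingleton (Abelian.Ext M N k)

/-- The projective dimension of `M`, valued in `ℕ∞` (infinite if no bound exists). -/
def projDim (A : Type) [Ring A] (M : ModuleCat.{0} A) : ℕ∞ :=
  sInf {e : ℕ∞ | ∃ n : ℕ, e = n ∧ projDimLE A M n}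

/-- `N` has injective dimension at most `n`, characterized by vanishing of
`Ext^k(-, N)` for `k > n`. -/
def injDimLE (A : Type) [Ring A] (N : ModuleCat.{0} A) (n : ℕ) : Prop :=
  ∀ (M : ModuleCat.{0} A) (k : ℕ), n < k → Subsingleton (Abelian.Ext M N k)

/-- The injective dimension of `N`, valued in `ℕ∞`. -/
def injDim (A : Type) [Ring A] (N : ModuleCat.{0} A) : ℕ∞ :=
  sInf {e : ℕ∞ | ∃ n : ℕ, e = n ∧ injDimLE A N n}

/-- The (left) global dimension of `A`: the supremum of projective dimensions of
all left `A`-modules. -/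
def globalDim (A : Type) [Ring A] : ℕ∞ :=
  ⨆ M : ModuleCat.{0} A, projDim A M

/-- `N` is the (first) syzygy of `M`: `N` is isomorphic to the kernel of a
projective cover `P → M` (a surjection from a projective module with superfluous
kernel, i.e. kernel contained in `J·P`). -/
def IsSyzygy (A : Type) [Ring A] (M N : ModuleCat.{0} A) : Prop :=
  ∃ (P : ModuleCat.{0} A) (f : P →ₗ[A] M), Module.Projective A P ∧
    Function.Surjective f ∧ LinearMap.ker f ≤ jSmul A (⊤ : Submodule A P) ∧
    Nonempty (N ≃ₗ[A] LinearMap.ker f)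

/-- `N` is the `n`-th syzygy `Ω^n M` of `M` in its minimal projective resolution. -/
def IsNthSyzygy (A : Type) [Ring A] : ℕ → ModuleCat.{0} A → ModuleCat.{0} A → Prop
  | 0, M, N => Nonempty (M ≃ₗ[A] N)
  | n + 1, M, N => ∃ K : ModuleCat.{0} A, IsNthSyzygy A n M K ∧ IsSyzygy A K N

/-- `S` is (isomorphic to) a direct summand of the module `W`. -/
def IsDirectSummandOf (A : Type) [Ring A] (S W : ModuleCat.{0} A) : Prop :=
  ∃ U V : Submodule A W, IsCompl U V ∧ Nonempty (S ≃ₗ[A] U)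

/-- The submodule `X` is a direct summand of the submodule `W` (inside a common
ambient module). -/
def IsSummandIn (A : Type) [Ring A] {P : Type} [AddCommGroup P] [Module A P]
    (X W : Submodule A P) : Prop :=
  X ≤ W ∧ ∃ C ≤ W, X ⊓ C = ⊥ ∧ X ⊔ C = W

/-- The module `N` (a submodule of an ambient module) has no simple direct summand. -/
def NoSimpleSummand (A : Type) [Ring A] {P : Type} [AddCommGroup P] [Module A P]
    (N : Submodule A P) : Prop :=
  ¬ ∃ S : Submodule A P, IsSimpleModule A S ∧ IsSummandIn A S N

/-- The order relation on simple modules: `S ⪯ T` iff `S` is a direct summand of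
some syzygy `Ω^m T`. -/
def Preceq (A : Type) [Ring A] (S T : ModuleCat.{0} A) : Prop :=
  ∃ (m : ℕ) (W : ModuleCat.{0} A), IsNthSyzygy A m T W ∧ IsDirectSummandOf A S W

/-- `Ext_A^n(S, S) = 0` for every simple `A`-module `S` and every `n ≥ m`. -/
def ExtSelfVanishes (A : Type) [Ring A] (m : ℕ) : Prop :=
  ∀ S : ModuleCat.{0} A, IsSimpleModule A S →
    ∀ n : ℕ, m ≤ n → Subsingleton (Abelian.Ext S S n)

/-- The Yoneda ring `E = ⊕ₙ Ext^n(A/J, A/J)` is generated in finite degrees: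
there is `s` such that every homogeneous element of degree `n > s` is a sum of
Yoneda products of homogeneous elements of positive degrees `< n`. -/
def YonedaGeneratedInFiniteDegrees (A : Type) [Ring A] : Prop :=
  ∃ s : ℕ, ∀ n : ℕ, s < n → ∀ e : Abelian.Ext (AmodJ A) (AmodJ A) n,
    e ∈ AddSubgroup.closure {x : Abelian.Ext (AmodJ A) (AmodJ A) n |
      ∃ (i j : ℕ) (h : i + j = n) (_ : 0 < i) (_ : 0 < j)
        (a : Abelian.Ext (AmodJ A) (AmodJ A) i)
        (b : Abelian.Ext (AmodJ A) (AmodJ A) j), x = a.comp b h}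

/-- The data of the canonical sequence `(M₀ = S, M₁, M₂, ...)` associated to a
simple module `S` over a ring with `J³ = 0`: for each `n`, `P n` is a projective
cover of `M n`, and its kernel (the syzygy `Ω M_n`) decomposes as
`M_{n+1} ⊕ Y_{n+1}`, where `Y_{n+1}` is a direct summand of `J²·P n` and
`M_{n+1} ∩ J²·P n = J·M_{n+1}`. -/
structure AssocSeqData (A : Type) [Ring A] (S : ModuleCat.{0} A) where
  M : ℕ → ModuleCat.{0} A
  iso0 : Nonempty (M 0 ≃ₗ[A] S)
  P : ℕ → ModuleCat.{0} A
  proj : ∀ n, Module.Projective A (P n)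
  π : ∀ n, P n →ₗ[A] M n
  surj : ∀ n, Function.Surjective (π n)
  cover : ∀ n, LinearMap.ker (π n) ≤ jSmul A (⊤ : Submodule A (P n))
  Msub : ∀ n, Submodule A (P n)
  Ysub : ∀ n, Submodule A (P n)
  isoM : ∀ n, Nonempty (M (n + 1) ≃ₗ[A] Msub n)
  indep : ∀ n, Msub n ⊓ Ysub n = ⊥
  sup_eq : ∀ n, Msub n ⊔ Ysub n = LinearMap.ker (π n)
  Y_summand : ∀ n, IsSummandIn A (Ysub n) (jSmul A (jSmul A (⊤ : Submodule A (P n))))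
  M_cap : ∀ n, Msub n ⊓ jSmul A (jSmul A (⊤ : Submodule A (P n))) = jSmul A (Msub n)

/-- The iterated Yoneda product `eₙ · ... · e₂ · e₁ · 1` of classes
`eᵢ ∈ Ext^1(S_{i-1}, S_i)`. -/
def extChain (A : Type) [Ring A] (S : ℕ → ModuleCat.{0} A)
    (e : ∀ i : ℕ, Abelian.Ext (S i) (S (i + 1)) 1) :
    ∀ n : ℕ, Abelian.Ext (S 0) (S n) n
  | 0 => Abelian.Ext.mk₀ (𝟙 (S 0))
  | n + 1 => (extChain A S e n).comp (e n) rfl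

/-- The iterated Yoneda product `eₙ · ... · e₁ · f` where `f ∈ Ext^0(S, A/J)` and
`eᵢ ∈ Ext^1(A/J, A/J)`. -/
def extChainFrom (A : Type) [Ring A] {S : ModuleCat.{0} A}
    (f : Abelian.Ext S (AmodJ A) 0)
    (e : ℕ → Abelian.Ext (AmodJ A) (AmodJ A) 1) :
    ∀ n : ℕ, Abelian.Ext S (AmodJ A) n
  | 0 => f
  | n + 1 => (extChainFrom A f e n).comp (e n) rfl

/-- Membership in `jrad A` is membership in the Jacobson radical. -/
theorem mem_jrad_iff {A : Type} [Ring A] {x : A} : x ∈ jrad A ↔ x ∈ Ring.jacobson A := by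
  rw [← TwoSidedIdeal.mem_asIdeal, jrad, TwoSidedIdeal.asIdeal_jacobson,
    TwoSidedIdeal.bot_asIdeal, Ideal.jacobson_bot]

theorem jSmul_eq_smul {A : Type} [Ring A] {M : Type} [AddCommGroup M] [Module A M]
    (N : Submodule A M) : jSmul A N = Ring.jacobson A • N := by
  apply le_antisymm
  · refine Submodule.span_le.mpr ?_
    rintro _ ⟨x, hx, m, hm, rfl⟩
    exact Submodule.smul_mem_smul (mem_jrad_iff.mp hx) hm
  · exact Submodule.smul_le.mpr fun x hx m hm =>
      Submodule.subset_span ⟨x, mem_jrad_iff.mpr hx, m, hm, rfl⟩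

/-- If all products of `n` elements of a left ideal `I` vanish, then `I ^ n = 0`. -/
theorem Ideal.pow_eq_bot_of_prod_eq_zero {A : Type*} [Ring A] {I : Ideal A} {n : ℕ}
    (h : ∀ l : List A, l.length = n → (∀ a ∈ l, a ∈ I) → l.prod = 0) : I ^ n = ⊥ := by
  have key : ∀ k, ∀ y ∈ I ^ k, ∀ l : List A, l.length + k = n → (∀ a ∈ l, a ∈ I) →
      y * l.prod = 0 := by
    intro k
    induction k with
    | zero =>
      intro y _ l hl hmem
      rw [h l (by simpa using hl) hmem, mul_zero]
    | succ k ih =>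
      intro y hy l hl hmem
      rw [Submodule.pow_succ] at hy
      refine Submodule.smul_induction_on hy (fun z hz a ha => ?_) fun u v hu hv => ?_
      · have := ih z hz (a :: l) (by simp; omega) (by
          intro b hb
          rcases List.mem_cons.mp hb with rfl | hb
          · exact ha
          · exact hmem b hb)
        simpa [mul_assoc] using this
      · rw [add_mul, hu, hv, add_zero]
  refine (Submodule.eq_bot_iff _).mpr fun y hy => ?_
  simpa using key n y hy [] (by simp) (by simp)

theorem IsSemiprimary.isSemiprimaryRing {A : Type} [Ring A] (hA : IsSemiprimary A) :
    IsSemiprimaryRing A where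
  isSemisimpleRing := by
    have := hA.1
    rw [SemisimpleModJ] at this
    let f : (jrad A).ringCon.Quotient →+* A ⧸ Ring.jacobson A :=
      (jrad A).ringCon.lift (Ideal.Quotient.mk _) (by
        intro x y hxy
        rw [RingCon.ker_apply]
        exact Ideal.Quotient.eq.mpr (mem_jrad_iff.mp ((TwoSidedIdeal.rel_iff _ _ _).mp hxy)))
    refine RingHom.isSemisimpleRing_of_surjective f fun y => ?_
    obtain ⟨x, rfl⟩ := Ideal.Quotient.mk_surjective y
    exact ⟨(jrad A).ringCon.mk' x, rfl⟩
  isNilpotent := by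
    obtain ⟨n, hn⟩ := hA.2
    refine ⟨n, Ideal.pow_eq_bot_of_prod_eq_zero ?_⟩
    rintro l rfl hmem
    have := hn l.get fun i => mem_jrad_iff.mpr (hmem _ (List.get_mem l i))
    rwa [List.ofFn_get] at this

/-- Nakayama's lemma for a nilpotent ideal. -/
theorem Submodule.eq_top_of_sup_smul_top_of_isNilpotent {A M : Type*} [Ring A] [AddCommGroup M]
    [Module A M] {I : Ideal A} (hI : IsNilpotent I) {N : Submodule A M}
    (h : N ⊔ I • (⊤ : Submodule A M) = ⊤) : N = ⊤ := by
  obtain ⟨n, hn⟩ := hI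
  have key : ∀ k, N ⊔ I ^ k • (⊤ : Submodule A M) = ⊤ := by
    intro k
    induction k with
    | zero => rw [Submodule.pow_zero, Ideal.one_eq_top, Submodule.top_smul, sup_top_eq]
    | succ k ih =>
      rw [eq_top_iff]
      calc (⊤ : Submodule A M) = N ⊔ I ^ k • (N ⊔ I • ⊤) := by rw [h, ih]
        _ ≤ N ⊔ I ^ (k + 1) • ⊤ := by
          rw [Submodule.smul_sup, Submodule.pow_succ, Submodule.mul_smul]
          exact sup_le le_sup_left (sup_le_sup_right Submodule.smul_le_right _)
  have := key n
  rwa [hn, Submodule.zero_eq_bot, Submodule.bot_smul, sup_bot_eq] at this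

/-- An endomorphism with image in `I • ⊤`, for `I` nilpotent, is nilpotent. -/
theorem Module.End.isNilpotent_of_range_le_smul_top {A M : Type*} [Ring A] [AddCommGroup M]
    [Module A M] {I : Ideal A} (hI : IsNilpotent I) (f : Module.End A M)
    (hf : LinearMap.range f ≤ I • (⊤ : Submodule A M)) : IsNilpotent f := by
  obtain ⟨n, hn⟩ := hI
  have key : ∀ k, LinearMap.range (f ^ k) ≤ I ^ k • (⊤ : Submodule A M) := by
    intro k
    induction k with
    | zero => rw [Submodule.pow_zero, Ideal.one_eq_top, Submodule.top_smul]; exact le_top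
    | succ k ih =>
      rw [pow_succ', Module.End.mul_eq_comp, LinearMap.range_comp, Submodule.pow_succ,
        Submodule.mul_smul]
      refine (Submodule.map_mono ih).trans ?_
      rw [Submodule.map_smul'', Submodule.map_top]
      exact Submodule.smul_mono le_rfl hf
  refine ⟨n, LinearMap.range_eq_bot.mp (le_bot_iff.mp ?_)⟩
  simpa [hn] using key n

/-- The ring homomorphism `End M → End (M / I M)`. -/
def Module.End.mapQSmulTop {A : Type*} (M : Type*) [Ring A] [AddCommGroup M] [Module A M]
    (I : Ideal A) : Module.End A M →+* Module.End A (M ⧸ I • (⊤ : Submodule A M)) where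
  toFun f := Submodule.mapQ _ _ f (Submodule.smul_top_le_comap_smul_top I f)
  map_one' := by ext; rfl
  map_zero' := by ext; rfl
  map_mul' _ _ := by ext; rfl
  map_add' _ _ := by ext; rfl

universe u v in
/-- Every module over a semiprimary ring has a projective cover. -/
theorem IsSemiprimaryRing.exists_projectiveCover (A : Type u) [Ring A] [IsSemiprimaryRing A]
    (M : Type v) [AddCommGroup M] [Module A M] :
    ∃ (P : Type max u v) (_ : AddCommGroup P) (_ : Module A P) (f : P →ₗ[A] M),
      Module.Projective A P ∧ Function.Surjective f ∧ LinearMap.ker f ≤ Ring.jacobson A • (⊤ : Submodule A P) := by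
  set I := Ring.jacobson A
  have hI : IsNilpotent I := IsSemiprimaryRing.isNilpotent
  let g : (M →₀ A) →ₗ[A] M := Finsupp.linearCombination A id
  have hg : Function.Surjective g := Finsupp.linearCombination_id_surjective A M
  let gbar := Submodule.mapQ _ _ g (Submodule.smul_top_le_comap_smul_top I g)
  have : IsSemisimpleModule A ((M →₀ A) ⧸ I • (⊤ : Submodule A (M →₀ A))) :=
    (Module.isTorsionBySet_quotient_ideal_smul _ I).isSemisimpleModule_iff.mp inferInstance
  obtain ⟨C, hC⟩ := exists_isCompl (LinearMap.ker gbar)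
  let e : Module.End A ((M →₀ A) ⧸ I • (⊤ : Submodule A (M →₀ A))) := C.projection _ hC.symm
  have he : IsIdempotentElem e := Submodule.isIdempotentElem_projection _
  have heC : ∀ x, e x ∈ C := fun x => by simp [e]
  have hge : ∀ x, gbar (e x) = gbar x := by
    intro x
    have h1 : e (x - e x) = 0 := by
      rw [map_sub, sub_eq_zero]
      exact (LinearMap.congr_fun he x).symm
    have h2 : x - e x ∈ LinearMap.ker gbar := by
      have : x - e x ∈ LinearMap.ker e := h1
      simpa [e] using this
    rw [LinearMap.mem_ker, map_sub, sub_eq_zero] at h2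
    exact h2.symm
  obtain ⟨e₀, he₀⟩ := Module.projective_lifting_property (Submodule.mkQ _)
    (e ∘ₗ Submodule.mkQ (I • (⊤ : Submodule A (M →₀ A)))) (Submodule.mkQ_surjective _)
  obtain ⟨p, hp, hpe⟩ := exists_isIdempotentElem_eq_of_ker_isNilpotent
    (Module.End.mapQSmulTop (M →₀ A) I)
    (fun x hx => Module.End.isNilpotent_of_range_le_smul_top hI x (by
      rintro _ ⟨y, rfl⟩
      rw [← Submodule.Quotient.mk_eq_zero]
      exact LinearMap.congr_fun (RingHom.mem_ker.mp hx) (Submodule.Quotient.mk y)))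
    e ⟨e₀, by ext1; exact he₀⟩ he
  have hpe' : ∀ x, Submodule.Quotient.mk (p x) = e (Submodule.Quotient.mk x) := fun x =>
    LinearMap.congr_fun hpe (Submodule.Quotient.mk x)
  have hpp : ∀ x ∈ LinearMap.range p, p x = x := fun x hx => (LinearMap.IsIdempotentElem.mem_range_iff hp).mp hx
  refine ⟨LinearMap.range p, inferInstance, inferInstance, g ∘ₗ (LinearMap.range p).subtype,
    Module.Projective.of_split (LinearMap.range p).subtype p.rangeRestrict ?_, ?_, ?_⟩
  · ext1 x
    exact Subtype.ext (hpp x x.2)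
  · rw [← LinearMap.range_eq_top]
    refine Submodule.eq_top_of_sup_smul_top_of_isNilpotent hI (eq_top_iff.mpr fun m _ => ?_)
    obtain ⟨x, rfl⟩ := hg m
    have h1 : g x - g (p x) ∈ I • (⊤ : Submodule A M) :=
      (Submodule.Quotient.eq _).mp
        (show gbar (Submodule.Quotient.mk x) = gbar (Submodule.Quotient.mk (p x)) by
          rw [hpe', hge])
    rw [← add_sub_cancel (g (p x)) (g x)]
    exact Submodule.add_mem_sup ⟨⟨p x, x, rfl⟩, rfl⟩ h1
  · intro y hy
    have hy0 : g y = 0 := hy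
    have hker : e (Submodule.Quotient.mk y) ∈ LinearMap.ker gbar := by
      rw [LinearMap.mem_ker, hge]
      change Submodule.Quotient.mk (g y) = _
      rw [hy0, Submodule.Quotient.mk_zero]
    have hzero := Submodule.disjoint_def.mp hC.disjoint _ hker (heC _)
    rw [← hpe', hpp _ y.2, Submodule.Quotient.mk_eq_zero] at hzero
    have := Submodule.smul_top_le_comap_smul_top I p.rangeRestrict hzero
    rw [Submodule.mem_comap] at this
    convert this
    exact Subtype.ext (hpp _ y.2).symm

section Syzygy

variable {A : Type} [Ring A]

theorem exists_isSyzygy [IsSemiprimaryRing A] (M : ModuleCat.{0} A) :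
    ∃ N : ModuleCat.{0} A, IsSyzygy A M N := by
  obtain ⟨P, _, _, f, hP, hf, hker⟩ := IsSemiprimaryRing.exists_projectiveCover A M
  refine ⟨ModuleCat.of A (LinearMap.ker f), ModuleCat.of A P, f, hP, hf, ?_,
    ⟨LinearEquiv.refl A (LinearMap.ker f)⟩⟩
  rw [jSmul_eq_smul]
  exact hker

theorem IsSyzygy.of_equiv {M M' N : ModuleCat.{0} A} (h : IsSyzygy A M N) (e : M ≃ₗ[A] M') :
    IsSyzygy A M' N := by
  obtain ⟨P, f, hP, hf, hker, ⟨i⟩⟩ := h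
  have hk : LinearMap.ker (e.toLinearMap ∘ₗ f) = LinearMap.ker f := e.ker_comp f
  exact ⟨P, e.toLinearMap ∘ₗ f, hP, e.surjective.comp hf, hk ▸ hker,
    ⟨i.trans (LinearEquiv.ofEq _ _ hk.symm)⟩⟩

theorem IsSyzygy.prod {M M' N N' : ModuleCat.{0} A} (h : IsSyzygy A M N)
    (h' : IsSyzygy A M' N') :
    IsSyzygy A (ModuleCat.of A (M × M')) (ModuleCat.of A (N × N')) := by
  obtain ⟨P, f, hP, hf, hker, ⟨i⟩⟩ := h
  obtain ⟨P', f', hP', hf', hker', ⟨i'⟩⟩ := h'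
  rw [jSmul_eq_smul] at hker hker'
  refine ⟨ModuleCat.of A (P × P'), f.prodMap f', inferInstanceAs (Module.Projective A (P × P')),
    hf.prodMap hf', ?_, ⟨?_⟩⟩
  · rw [jSmul_eq_smul]
    rintro ⟨x, y⟩ hxy
    rw [LinearMap.ker_prodMap] at hxy
    have hx := Submodule.smul_top_le_comap_smul_top _ (LinearMap.inl A P P') (hker hxy.1)
    have hy := Submodule.smul_top_le_comap_smul_top _ (LinearMap.inr A P P') (hker' hxy.2)
    have := add_mem (Submodule.mem_comap.mp hx) (Submodule.mem_comap.mp hy)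
    simpa using this
  · refine (i.prodCongr i').trans (M₃ := LinearMap.ker (f.prodMap f'))
      { toFun := fun z => ⟨(z.1.1, z.2.1), by
          rw [LinearMap.ker_prodMap]; exact ⟨z.1.2, z.2.2⟩⟩
        map_add' := fun _ _ => rfl
        map_smul' := fun _ _ => rfl
        invFun := fun z =>
          have hz : z.1 ∈ (LinearMap.ker f).prod (LinearMap.ker f') :=
            (LinearMap.ker_prodMap f f').le z.2
          (⟨z.1.1, hz.1⟩, ⟨z.1.2, hz.2⟩)
        left_inv := fun _ => rfl
        right_inv := fun _ => rfl }

theorem IsNthSyzygy.of_equiv {M M' : ModuleCat.{0} A} (e : M ≃ₗ[A] M') :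
    ∀ {n : ℕ} {N : ModuleCat.{0} A}, IsNthSyzygy A n M N → IsNthSyzygy A n M' N
  | 0, _, ⟨i⟩ => ⟨e.symm.trans i⟩
  | _ + 1, _, ⟨K, hK, hN⟩ => ⟨K, hK.of_equiv e, hN⟩

theorem IsNthSyzygy.trans {m n : ℕ} {M N L : ModuleCat.{0} A} (h : IsNthSyzygy A n M N)
    (h' : IsNthSyzygy A m N L) : IsNthSyzygy A (n + m) M L := by
  induction m generalizing L with
  | zero =>
    obtain ⟨e⟩ := h'
    cases n with
    | zero => exact ⟨h.some.trans e⟩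
    | succ n =>
      obtain ⟨K, hK, P, f, hP, hf, hker, ⟨i⟩⟩ := h
      exact ⟨K, hK, P, f, hP, hf, hker, ⟨e.symm.trans i⟩⟩
  | succ m ih =>
    obtain ⟨K, hK, hL⟩ := h'
    exact ⟨K, ih hK, hL⟩

theorem IsNthSyzygy.exists_prod [IsSemiprimaryRing A] {n : ℕ} {M N : ModuleCat.{0} A}
    (h : IsNthSyzygy A n M N) (V : ModuleCat.{0} A) :
    ∃ V' : ModuleCat.{0} A,
      IsNthSyzygy A n (ModuleCat.of A (M × V)) (ModuleCat.of A (N × V')) := by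
  induction n generalizing N with
  | zero => exact ⟨V, ⟨h.some.prodCongr (LinearEquiv.refl A V)⟩⟩
  | succ n ih =>
    obtain ⟨K, hK, hN⟩ := h
    obtain ⟨V₁, hV₁⟩ := ih hK
    obtain ⟨V₂, hV₂⟩ := exists_isSyzygy V₁
    exact ⟨V₂, _, hV₁, hN.prod hV₂⟩

theorem isDirectSummandOf_iff_exists_retraction {S W : ModuleCat.{0} A} :
    IsDirectSummandOf A S W ↔ ∃ (i : S →ₗ[A] W) (r : W →ₗ[A] S), r ∘ₗ i = LinearMap.id := by
  constructor
  · rintro ⟨U, V, hUV, ⟨e⟩⟩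
    refine ⟨U.subtype ∘ₗ e.toLinearMap, e.symm.toLinearMap ∘ₗ U.projectionOnto V hUV, ?_⟩
    ext x
    simp
  · rintro ⟨i, r, hri⟩
    have hri' : ∀ x, r (i x) = x := LinearMap.congr_fun hri
    have hinj : Function.Injective i := Function.LeftInverse.injective hri'
    refine ⟨LinearMap.range i, LinearMap.ker (i.rangeRestrict ∘ₗ r),
      LinearMap.isCompl_of_proj ?_, ⟨LinearEquiv.ofInjective i hinj⟩⟩
    rintro ⟨_, x, rfl⟩
    exact Subtype.ext (congrArg i (hri' x))

theorem IsDirectSummandOf.exists_nthSyzygy [IsSemiprimaryRing A] {m n : ℕ}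
    {S T U W₁ W₂ : ModuleCat.{0} A} (hW₂ : IsNthSyzygy A m T W₂)
    (hS : IsDirectSummandOf A S W₂) (hW₁ : IsNthSyzygy A n U W₁)
    (hT : IsDirectSummandOf A T W₁) :
    ∃ W, IsNthSyzygy A (n + m) U W ∧ IsDirectSummandOf A S W := by
  obtain ⟨X, Y, hXY, ⟨e⟩⟩ := hT
  obtain ⟨V', hV'⟩ := hW₂.exists_prod (ModuleCat.of A Y)
  refine ⟨_, hW₁.trans (hV'.of_equiv (M' := W₁)
    ((e.prodCongr (LinearEquiv.refl A Y)).trans (Submodule.prodEquivOfIsCompl X Y hXY))), ?_⟩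
  obtain ⟨i, r, hri⟩ := isDirectSummandOf_iff_exists_retraction.mp hS
  refine isDirectSummandOf_iff_exists_retraction.mpr
    ⟨LinearMap.inl A W₂ V' ∘ₗ i, r ∘ₗ LinearMap.fst A W₂ V', ?_⟩
  ext x
  exact LinearMap.congr_fun hri x

theorem IsDirectSummandOf.equiv_of_isSimpleModule {S T : ModuleCat.{0} A}
    [IsSimpleModule A S] [IsSimpleModule A T] (h : IsDirectSummandOf A S T) :
    Nonempty (S ≃ₗ[A] T) := by
  obtain ⟨i, r, hri⟩ := isDirectSummandOf_iff_exists_retraction.mp h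
  rcases i.bijective_or_eq_zero with hi | rfl
  · exact ⟨LinearEquiv.ofBijective i hi⟩
  · have := IsSimpleModule.nontrivial A S
    obtain ⟨x, hx⟩ := exists_ne (0 : S)
    exact absurd (by simpa using (LinearMap.congr_fun hri x).symm) hx

/-- Dimension shifting along a minimal projective presentation, towards a module annihilated by
the radical; minimality makes it work in degree zero as well. -/
theorem IsSyzygy.nontrivial_ext_succ {M N S : ModuleCat.{0} A} (h : IsSyzygy A M N)
    (hS : Ring.jacobson A ≤ Module.annihilator A S) (j : ℕ) [Nontrivial (Abelian.Ext N S j)] :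
    Nontrivial (Abelian.Ext M S (j + 1)) := by
  obtain ⟨P, f, hP, hf, hker, ⟨e⟩⟩ := h
  rw [jSmul_eq_smul] at hker
  let ι : N →ₗ[A] P := (LinearMap.ker f).subtype ∘ₗ e.toLinearMap
  have hι : ∀ x, f (ι x) = 0 := fun x => (e x).2
  let C : ShortComplex (ModuleCat.{0} A) :=
    ShortComplex.mk (ModuleCat.ofHom ι) (ModuleCat.ofHom f) (by ext x; exact hι x)
  have hC : C.ShortExact :=
    { exact := (ShortComplex.moduleCat_exact_iff C).mpr fun x hx =>
        ⟨e.symm ⟨x, hx⟩, congrArg Subtype.val (e.apply_symm_apply _)⟩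
      mono_f := (ModuleCat.mono_iff_injective _).mpr
        (Subtype.val_injective.comp e.injective)
      epi_g := (ModuleCat.epi_iff_surjective _).mpr hf }
  have : Projective P := (IsProjective.iff_projective P).mp hP
  have hzero : ∀ y : Abelian.Ext P S j,
      (Abelian.Ext.mk₀ C.f).comp y (zero_add j) = 0 := by
    intro y
    cases j with
    | succ j => rw [Abelian.Ext.eq_zero_of_projective y, Abelian.Ext.comp_zero]
    | zero =>
      obtain ⟨φ, rfl⟩ := Abelian.Ext.addEquiv₀.symm.surjective y
      have hφ : C.f ≫ φ = 0 := by
        ext x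
        have h1 := Submodule.smul_top_le_comap_smul_top _ φ.hom (hker (e x).2)
        have h2 : Ring.jacobson A • (⊤ : Submodule A S) = ⊥ :=
          (Submodule.eq_bot_iff _).mpr fun s hs =>
            Submodule.smul_induction_on hs
              (fun a ha s _ => Module.mem_annihilator.mp (hS ha) s)
              fun a b ha hb => by rw [ha, hb, add_zero]
        rw [h2] at h1
        exact h1
      simp [hφ]
  obtain ⟨x, hx⟩ := exists_ne (0 : Abelian.Ext N S j)
  refine ⟨hC.extClass.comp x (add_comm 1 j), 0, fun hx0 => hx ?_⟩
  obtain ⟨y, rfl⟩ := Abelian.Ext.contravariant_sequence_exact₁ hC S x (add_comm 1 j) hx0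
  exact hzero y

theorem IsNthSyzygy.nontrivial_ext {n : ℕ} {M N S : ModuleCat.{0} A} (h : IsNthSyzygy A n M N)
    (hS : Ring.jacobson A ≤ Module.annihilator A S) (j : ℕ) [Nontrivial (Abelian.Ext N S j)] :
    Nontrivial (Abelian.Ext M S (j + n)) := by
  induction n generalizing N j with
  | zero =>
    obtain ⟨e⟩ := h
    obtain ⟨x, hx⟩ := exists_ne (0 : Abelian.Ext N S j)
    refine ⟨(Abelian.Ext.mk₀ e.toModuleIso.hom).comp x (zero_add j), 0, fun hx0 => hx ?_⟩
    have := congrArg (fun z => (Abelian.Ext.mk₀ e.toModuleIso.inv).comp z (zero_add j)) hx0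
    rw [Abelian.Ext.mk₀_comp_mk₀_assoc, e.toModuleIso.inv_hom_id, Abelian.Ext.mk₀_id_comp,
      Abelian.Ext.comp_zero] at this
    exact this
  | succ n ih =>
    obtain ⟨K, hK, hN⟩ := h
    have := hN.nontrivial_ext_succ hS j
    have := ih hK (j + 1)
    rwa [add_right_comm, add_assoc] at this

theorem IsNthSyzygy.nontrivial_ext_of_isDirectSummandOf {n : ℕ} {M N S : ModuleCat.{0} A}
    [IsSimpleModule A S] (h : IsNthSyzygy A n M N) (hS : IsDirectSummandOf A S N) :
    Nontrivial (Abelian.Ext M S n) := by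
  obtain ⟨i, r, hri⟩ := isDirectSummandOf_iff_exists_retraction.mp hS
  have : Nontrivial (Abelian.Ext N S 0) := by
    refine ⟨Abelian.Ext.mk₀ (ModuleCat.ofHom r), 0, fun h0 => ?_⟩
    have hr : ModuleCat.ofHom r = 0 := (Abelian.Ext.mk₀_eq_zero_iff _).mp h0
    have := IsSimpleModule.nontrivial A S
    obtain ⟨x, hx⟩ := exists_ne (0 : S)
    apply hx
    rw [← LinearMap.id_apply (R := A) x, ← hri]
    exact LinearMap.congr_fun (congrArg ModuleCat.Hom.hom hr) (i x)
  have := h.nontrivial_ext (IsSemisimpleModule.jacobson_le_annihilator A S) 0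
  rwa [zero_add] at this

theorem IsDirectSummandOf.exists_nthSyzygy_mul [IsSemiprimaryRing A] {n : ℕ}
    {S W : ModuleCat.{0} A} (hW : IsNthSyzygy A n S W) (hS : IsDirectSummandOf A S W) (k : ℕ) :
    ∃ W', IsNthSyzygy A (n * k) S W' ∧ IsDirectSummandOf A S W' := by
  induction k with
  | zero =>
    exact ⟨S, ⟨LinearEquiv.refl A S⟩,
      isDirectSummandOf_iff_exists_retraction.mpr ⟨LinearMap.id, LinearMap.id, rfl⟩⟩
  | succ k ih =>
    obtain ⟨W', hW', hS'⟩ := ih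
    exact hS.exists_nthSyzygy hW hW' hS'

end Syzygy

/-- Under the hypothesis that `Ext^n(S, S) = 0` for `n ≫ 0` for each simple `S`,
the relation `S ⪯ T` iff `S` is a direct summand of some syzygy `Ωᵐ T` is a
partial order (reflexive, transitive and antisymmetric up to isomorphism) on
simple modules over a semiprimary ring. -/
theorem stmt_10 (A : Type) [Ring A] (hA : IsSemiprimary A)
    (hvan : ∀ S : ModuleCat.{0} A, IsSimpleModule A S →
      ∃ m : ℕ, ∀ n : ℕ, m ≤ n → Subsingleton (Abelian.Ext S S n)) :
    (∀ S : ModuleCat.{0} A, IsSimpleModule A S → Preceq A S S) ∧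
    (∀ S T U : ModuleCat.{0} A, IsSimpleModule A S → IsSimpleModule A T →
      IsSimpleModule A U → Preceq A S T → Preceq A T U → Preceq A S U) ∧
    (∀ S T : ModuleCat.{0} A, IsSimpleModule A S → IsSimpleModule A T →
      Preceq A S T → Preceq A T S → Nonempty (S ≃ₗ[A] T)) := by
  have := hA.isSemiprimaryRing
  refine ⟨fun S _ => ⟨0, S, ⟨LinearEquiv.refl A S⟩,
    isDirectSummandOf_iff_exists_retraction.mpr ⟨LinearMap.id, LinearMap.id, rfl⟩⟩, ?_, ?_⟩
  · rintro S T U _ _ _ ⟨m, W₂, hW₂, hS⟩ ⟨n, W₁, hW₁, hT⟩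
    exact ⟨n + m, hS.exists_nthSyzygy hW₂ hW₁ hT⟩
  · rintro S T _ _ ⟨m, W₂, hW₂, hS⟩ ⟨n, W₁, hW₁, hT⟩
    obtain ⟨W, hW, hSW⟩ := hS.exists_nthSyzygy hW₂ hW₁ hT
    rcases Nat.eq_zero_or_pos (n + m) with h0 | hpos
    · obtain ⟨rfl, rfl⟩ : n = 0 ∧ m = 0 := by omega
      obtain ⟨e⟩ := hW₂
      have : IsSimpleModule A W₂ := IsSimpleModule.congr e.symm
      obtain ⟨e'⟩ := hS.equiv_of_isSimpleModule
      exact ⟨e'.trans e.symm⟩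
    · obtain ⟨k, hk⟩ := hvan S inferInstance
      obtain ⟨W', hW', hSW'⟩ := hSW.exists_nthSyzygy_mul hW k
      have := hW'.nontrivial_ext_of_isDirectSummandOf hSW'
      have := hk ((n + m) * k) (Nat.le_mul_of_pos_left k hpos)
      exact absurd this (not_subsingleton _)

end
end

section
/- Let A be a ring such that A/J is semisimple and J^3 = 0, where J = J(A). If there exists m > 0 such that Ext_A^n(S, S) = 0 for all simple A-modules S and all n ≥ m, then A has finite global dimension. -/
open CategoryTheory

noncomputable section

section RingLemmas

variable {A : Type} [Ring A] {J : Ideal A}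

theorem isSemisimpleRing_quotient_jrad (hss : SemisimpleModJ A) :
    IsSemisimpleRing (A ⧸ (jrad A).asIdeal) := by
  have : IsSemisimpleRing (jrad A).ringCon.Quotient := hss
  let f : (jrad A).ringCon.Quotient →+* A ⧸ (jrad A).asIdeal :=
    RingCon.lift _ (Ideal.Quotient.mk (jrad A).asIdeal) (by
      intro x y h
      rw [RingCon.ker_apply]
      exact Ideal.Quotient.eq.mpr (by
        rw [TwoSidedIdeal.mem_asIdeal]
        exact (TwoSidedIdeal.rel_iff _ _ _).mp h))
  refine RingHom.isSemisimpleRing_of_surjective f ?_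
  intro x
  obtain ⟨a, rfl⟩ := Ideal.Quotient.mk_surjective x
  exact ⟨(a : (jrad A).ringCon.Quotient), rfl⟩

theorem isSemisimpleModule_of_isTorsionBySet [J.IsTwoSided] [IsSemisimpleRing (A ⧸ J)] {M : Type}
    [AddCommGroup M] [Module A M] (h : Module.IsTorsionBySet A M J) : IsSemisimpleModule A M := by
  let := h.module
  exact h.isSemisimpleModule_iff.mp inferInstance

/-- The `J`-cube-zero condition in terms of ideals. -/
def CubeZero (J : Ideal A) : Prop := ∀ x ∈ J, ∀ y ∈ J, ∀ z ∈ J, x * y * z = 0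

variable {M N : Type} [AddCommGroup M] [Module A M] [AddCommGroup N] [Module A N]

theorem isTorsionBySet_iff_smul_top : Module.IsTorsionBySet A M J ↔ J • (⊤ : Submodule A M) = ⊥ := by
  constructor
  · intro h
    rw [eq_bot_iff, Submodule.smul_le]
    intro r hr n _
    exact @h n ⟨r, hr⟩
  · intro h x r
    have : (r : A) • x ∈ J • (⊤ : Submodule A M) := Submodule.smul_mem_smul r.2 trivial
    rw [h] at this
    exact this

theorem smul_cube (h3 : CubeZero J) (N : Submodule A M) : J • (J • (J • N)) = ⊥ := by
  rw [← Submodule.smul_assoc, ← Submodule.smul_assoc, eq_bot_iff, Submodule.smul_le]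
  intro r hr n hn
  suffices r = 0 by simp [this]
  induction hr using Submodule.smul_induction_on' with
  | smul a ha b hb =>
    induction ha using Submodule.smul_induction_on' with
    | smul c hc d hd => exact h3 c hc d hd b hb
    | add c _ d _ h1 h2 => rw [smul_eq_mul] at *; rw [add_mul, h1, h2, add_zero]
  | add c _ d _ h1 h2 => rw [h1, h2, add_zero]

theorem nakayama (h3 : CubeZero J) {K : Submodule A M} (h : K ⊔ J • (⊤ : Submodule A M) = ⊤) :
    K = ⊤ := by
  have key : ∀ L : Submodule A M, K ⊔ L = ⊤ → K ⊔ J • L = ⊤ := by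
    intro L hL
    have : J • (⊤ : Submodule A M) ≤ K ⊔ J • L := by
      rw [← hL, Submodule.smul_sup]
      exact sup_le_sup_right Submodule.smul_le_right _
    rw [eq_top_iff, ← h]
    exact sup_le le_sup_left this
  have := key _ (key _ h)
  rwa [smul_cube h3, sup_bot_eq] at this

theorem isTorsionBySet_of_isSimpleModule (h3 : CubeZero J) [IsSimpleModule A M] :
    Module.IsTorsionBySet A M J := by
  rw [isTorsionBySet_iff_smul_top]
  refine (eq_bot_or_eq_top (J • (⊤ : Submodule A M))).resolve_right fun h => ?_
  have := nakayama (J := J) (K := (⊥ : Submodule A M)) h3 (by rw [h, bot_sup_eq])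
  exact bot_ne_top this

theorem Module.IsTorsionBySet.of_injective {s : Set A} (h : Module.IsTorsionBySet A N s) (f : M →ₗ[A] N)
    (hf : Function.Injective f) : Module.IsTorsionBySet A M s := fun x a =>
  hf (by rw [map_smul, map_zero]; exact @h (f x) a)

theorem Module.IsTorsionBySet.map_smul_top_eq_zero (h : Module.IsTorsionBySet A N J) (f : M →ₗ[A] N)
    {x : M} (hx : x ∈ J • (⊤ : Submodule A M)) : f x = 0 := by
  have : J • (⊤ : Submodule A M) ≤ LinearMap.ker f := by
    rw [Submodule.smul_le]
    intro r hr n _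
    rw [LinearMap.mem_ker, map_smul]
    exact @h (f n) ⟨r, hr⟩
  exact this hx

/-- A family of simple modules meeting every isomorphism class of simple modules. -/
structure IsCompleteSimpleFamily {ι : Type} (S : ι → ModuleCat.{0} A) : Prop where
  isSimple : ∀ i, IsSimpleModule A (S i)
  exists_equiv : ∀ (M : Type) [AddCommGroup M] [Module A M], IsSimpleModule A M →
    ∃ i, Nonempty (M ≃ₗ[A] S i)

theorem exists_isCompleteSimpleFamily [J.IsTwoSided] [IsSemisimpleRing (A ⧸ J)] (h3 : CubeZero J) :
    ∃ (n : ℕ) (S : Fin n → ModuleCat.{0} A), IsCompleteSimpleFamily S := by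
  have hT : Module.IsTorsionBySet A (A ⧸ J) J :=
    (Module.isTorsionBySet_quotient_iff _ _).mpr fun x r hr => J.mul_mem_right x hr
  have := isSemisimpleModule_of_isTorsionBySet hT
  obtain ⟨n, S, e, hS⟩ := IsSemisimpleModule.exists_linearEquiv_fin_dfinsupp A (A ⧸ J)
  refine ⟨n, fun i => ModuleCat.of A (S i), hS, fun M _ _ hM => ?_⟩
  have hM' := isTorsionBySet_of_isSimpleModule (M := M) h3
  have := IsSimpleModule.nontrivial A M
  obtain ⟨x, hx⟩ := exists_ne (0 : M)
  let f : (A ⧸ J) →ₗ[A] M := Submodule.liftQ J (LinearMap.toSpanSingleton A M x) (by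
    intro a ha
    exact @hM' x ⟨a, ha⟩)
  have hf : f ∘ₗ e.symm.toLinearMap ≠ 0 := by
    intro h
    apply hx
    have h' : f (e.symm (e (Submodule.Quotient.mk 1))) = 0 :=
      LinearMap.congr_fun h (e (Submodule.Quotient.mk 1))
    rw [LinearEquiv.symm_apply_apply] at h'
    exact (one_smul A x).symm.trans h'
  by_contra! hcon
  apply hf
  refine DFinsupp.lhom_ext' fun i => ?_
  by_contra hi
  have := hS i
  have hb := LinearMap.bijective_of_ne_zero hi
  exact not_nonempty_iff.mpr (hcon i) ⟨(LinearEquiv.ofBijective _ hb).symm⟩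

theorem exists_isotypic_decomposition [J.IsTwoSided] [IsSemisimpleRing (A ⧸ J)] {ι : Type} [Fintype ι]
    {S : ι → ModuleCat.{0} A} (hS : IsCompleteSimpleFamily S) (hM : Module.IsTorsionBySet A M J) :
    ∃ (κ : ι → Type) (p : ∀ i, M →ₗ[A] (κ i →₀ S i)) (q : ∀ i, (κ i →₀ S i) →ₗ[A] M),
      (∀ i, Function.Injective (q i)) ∧ ∑ i, q i ∘ₗ p i = LinearMap.id := by
  classical
  have := isSemisimpleModule_of_isTorsionBySet hM
  have h1 : ∀ i, ∃ κ : Type, Nonempty (isotypicComponent A M (S i) ≃ₗ[A] (κ →₀ S i)) := fun i =>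
    have := hS.isSimple i
    IsIsotypicOfType.linearEquiv_finsupp (IsIsotypicOfType.isotypicComponent A M (S i))
  choose κ e using h1
  let q : ∀ i, (κ i →₀ S i) →ₗ[A] M := fun i =>
    (isotypicComponent A M (S i)).subtype ∘ₗ (e i).some.symm.toLinearMap
  have hq : ∀ i, LinearMap.range (q i) = isotypicComponent A M (S i) := fun i => by
    rw [LinearMap.range_comp, LinearEquiv.range, Submodule.map_top, Submodule.range_subtype]
  have hsup : ⨆ i, LinearMap.range (q i) = ⊤ := by
    rw [eq_top_iff, ← IsSemisimpleModule.sSup_simples_eq_top A M]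
    refine sSup_le fun m hm => ?_
    obtain ⟨i, ⟨f⟩⟩ := hS.exists_equiv m hm
    refine le_trans ?_ (le_iSup _ i)
    rw [hq]
    exact le_sSup ⟨f⟩
  let F : (∀ i, κ i →₀ S i) →ₗ[A] M := LinearMap.lsum A (fun i => κ i →₀ S i) ℕ q
  have hF : Function.Surjective F := by
    rw [← LinearMap.range_eq_top, eq_top_iff, ← hsup]
    refine iSup_le fun i => ?_
    rintro _ ⟨x, rfl⟩
    refine ⟨Pi.single i x, ?_⟩
    rw [show F = LinearMap.lsum A (fun i => κ i →₀ S i) ℕ q from rfl, LinearMap.lsum_piSingle]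
  have hss : IsSemisimpleModule A (∀ i, κ i →₀ S i) := by
    have := hS.isSimple
    infer_instance
  obtain ⟨s, hs⟩ := IsSemisimpleModule.lifting_property F hF LinearMap.id
  refine ⟨κ, fun i => LinearMap.proj i ∘ₗ s, q, fun i => ?_, ?_⟩
  · exact (Submodule.injective_subtype _).comp (LinearEquiv.injective _)
  · rw [← hs]
    ext x
    simp [F, LinearMap.lsum_apply]

end RingLemmas

section ProjectiveCover

variable {A : Type} [Ring A] {J : Ideal A} [J.IsTwoSided] [IsSemisimpleRing (A ⧸ J)]

theorem exists_projectiveCover_of_isSimpleModule (h3 : CubeZero J) (M : Type) [AddCommGroup M]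
    [Module A M] [IsSimpleModule A M] :
    ∃ (P : ModuleCat.{0} A) (f : P →ₗ[A] M), Module.Projective A P ∧ Function.Surjective f ∧
      LinearMap.ker f ≤ J • (⊤ : Submodule A P) := by
  have hT : Module.IsTorsionBySet A (A ⧸ J) J :=
    (Module.isTorsionBySet_quotient_iff _ _).mpr fun x r hr => J.mul_mem_right x hr
  have := isSemisimpleModule_of_isTorsionBySet hT
  have hM := isTorsionBySet_of_isSimpleModule (M := M) h3
  have := IsSimpleModule.nontrivial A M
  obtain ⟨x, hx⟩ := exists_ne (0 : M)
  have hsurj := IsSimpleModule.toSpanSingleton_surjective A hx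
  let f : (A ⧸ J) →ₗ[A] M := Submodule.liftQ J (LinearMap.toSpanSingleton A M x)
    fun a ha => @hM x ⟨a, ha⟩
  have hf : Function.Surjective f := fun y => by
    obtain ⟨a, rfl⟩ := hsurj y
    exact ⟨Submodule.Quotient.mk a, rfl⟩
  obtain ⟨s, hs⟩ := IsSemisimpleModule.lifting_property f hf LinearMap.id
  obtain ⟨a, ha⟩ := Ideal.Quotient.mk_surjective (s x)
  have hmk : ∀ b c : A, b • (Ideal.Quotient.mk J c) = Ideal.Quotient.mk J (b * c) := fun _ _ => rfl
  have hba : ∀ b : A, Ideal.Quotient.mk J (b * a) = s (b • x) := fun b => by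
    rw [map_smul, ← ha, hmk]
  have hax : a • x = x := by
    have h1 : f (Ideal.Quotient.mk J a) = x := by rw [ha]; exact LinearMap.congr_fun hs x
    exact h1
  have hid : IsIdempotentElem (Ideal.Quotient.mk J a) := by
    rw [IsIdempotentElem, ← map_mul, hba, hax, ha]
  obtain ⟨e, he, hea⟩ := exists_isIdempotentElem_eq_of_ker_isNilpotent (Ideal.Quotient.mk J)
    (fun y hy => ⟨3, by
      rw [Ideal.mk_ker] at hy
      rw [pow_succ, pow_two]
      exact h3 y hy y hy y hy⟩) _ ⟨a, rfl⟩ hid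
  have hex : e • x = x := by
    have h1 : (e - a) • x = 0 := @hM x ⟨e - a, Ideal.Quotient.eq.mp hea⟩
    rwa [sub_smul, sub_eq_zero, hax] at h1
  let P : Submodule A A := LinearMap.range (LinearMap.toSpanSingleton A A e)
  have hP : ∀ b ∈ P, b * e = b := by
    rintro _ ⟨c, rfl⟩
    change c * e * e = c * e
    rw [mul_assoc, he]
  have heP : e ∈ P := ⟨1, one_mul e⟩
  refine ⟨ModuleCat.of A P, LinearMap.toSpanSingleton A M x ∘ₗ P.subtype, ?_, ?_, ?_⟩
  · refine Module.Projective.of_split P.subtype (LinearMap.toSpanSingleton A A e).rangeRestrict ?_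
    ext b
    exact hP b b.2
  · intro y
    obtain ⟨b, rfl⟩ := hsurj y
    refine ⟨⟨b * e, b, rfl⟩, ?_⟩
    change (b * e) • x = b • x
    rw [mul_smul, hex]
  · rintro ⟨b, hb⟩ hbx
    have hbx : b • x = 0 := hbx
    have hbJ : b ∈ J := by
      rw [← hP b hb, ← Ideal.Quotient.eq_zero_iff_mem, map_mul, hea, ← map_mul, hba, hbx, map_zero]
    have : (⟨b, hb⟩ : P) = b • (⟨e, heP⟩ : P) := Subtype.ext (hP b hb).symm
    rw [this]
    exact Submodule.smul_mem_smul hbJ trivial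

theorem exists_projectiveCover (h3 : CubeZero J) (M : Type) [AddCommGroup M] [Module A M] :
    ∃ (P : ModuleCat.{0} A) (f : P →ₗ[A] M), Module.Projective A P ∧ Function.Surjective f ∧
      LinearMap.ker f ≤ J • (⊤ : Submodule A P) := by
  classical
  have := isSemisimpleModule_of_isTorsionBySet (Module.isTorsionBySet_quotient_ideal_smul M J)
  obtain ⟨s, e, -, hs⟩ :=
    IsSemisimpleModule.exists_linearEquiv_dfinsupp A (M ⧸ J • (⊤ : Submodule A M))
  choose P f hP hf hker using fun m : s =>
    have := hs m
    exists_projectiveCover_of_isSimpleModule h3 m.1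
  let g : (Π₀ m : s, P m) →ₗ[A] (M ⧸ J • (⊤ : Submodule A M)) :=
    e.symm.toLinearMap ∘ₗ DFinsupp.mapRange.linearMap f
  have hg : Function.Surjective g := e.symm.surjective.comp
    ((DFinsupp.mapRange_surjective _ fun m => map_zero (f m)).mpr hf)
  have hgker : LinearMap.ker g ≤ J • (⊤ : Submodule A (Π₀ m : s, P m)) := by
    intro x hx
    have hx : e.symm (DFinsupp.mapRange.linearMap f x) = 0 := hx
    rw [LinearEquiv.map_eq_zero_iff] at hx
    rw [← DFinsupp.sum_single (f := x)]
    refine Submodule.sum_mem _ fun m _ => ?_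
    have hm : x m ∈ J • (⊤ : Submodule A (P m)) := hker m (DFunLike.congr_fun hx m)
    have h1 : DFinsupp.lsingle (R := A) m (x m) ∈
        (J • (⊤ : Submodule A (P m))).map (DFinsupp.lsingle (R := A) (M := fun m => P m) m) :=
      Submodule.mem_map_of_mem hm
    rw [Submodule.map_smul''] at h1
    exact Submodule.smul_mono le_rfl le_top h1
  have : Module.Projective A (Π₀ m : s, P m) :=
    inferInstanceAs (Module.Projective A (DirectSum s fun m => P m))
  obtain ⟨F, hF⟩ := Module.projective_lifting_property (J • (⊤ : Submodule A M)).mkQ g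
    (Submodule.mkQ_surjective _)
  refine ⟨ModuleCat.of A (Π₀ m : s, P m), F, this, ?_, ?_⟩
  · rw [← LinearMap.range_eq_top]
    apply nakayama h3
    rw [eq_top_iff]
    intro y _
    obtain ⟨x, hx⟩ := hg (Submodule.mkQ _ y)
    rw [← hF] at hx
    have h1 : y - F x ∈ J • (⊤ : Submodule A M) := by
      rw [← Submodule.Quotient.mk_eq_zero, Submodule.Quotient.mk_sub, sub_eq_zero]
      exact hx.symm
    rw [← add_sub_cancel (F x) y]
    exact Submodule.add_mem_sup ⟨x, rfl⟩ h1
  · refine le_trans ?_ hgker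
    rw [← hF]
    exact LinearMap.ker_le_ker_comp _ _

end ProjectiveCover

section Splitting

variable {A : Type} [Ring A] {J : Ideal A} [J.IsTwoSided] [IsSemisimpleRing (A ⧸ J)]

theorem exists_torsion_splitting (h3 : CubeZero J) {P : Type} [AddCommGroup P] [Module A P]
    (K : Submodule A P) (hK : K ≤ J • (⊤ : Submodule A P)) :
    ∃ (M Y : ModuleCat.{0} A) (i : M →ₗ[A] K) (j : Y →ₗ[A] K) (r : K →ₗ[A] M) (t : K →ₗ[A] Y),
      r ∘ₗ i = LinearMap.id ∧ t ∘ₗ j = LinearMap.id ∧ i ∘ₗ r + j ∘ₗ t = LinearMap.id ∧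
      Module.IsTorsionBySet A Y J ∧
      ∀ (Z : ModuleCat.{0} A) (_ : Module.IsTorsionBySet A Z J) (g : M →ₗ[A] Z),
        ∃ h : (J • (⊤ : Submodule A P) : Submodule A P) →ₗ[A] Z,
          h ∘ₗ Submodule.inclusion hK = g ∘ₗ r := by
  let L : Submodule A P := J • ⊤
  let N : Submodule A K := (J • L).comap K.subtype
  have hN : Module.IsTorsionBySet A N J := fun x a => by
    have h1 : (a : A) • (x : K).1 ∈ J • (J • L) := Submodule.smul_mem_smul a.2 x.2
    rw [smul_cube h3] at h1
    exact Subtype.ext (Subtype.ext h1)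
  have hJK : J • (⊤ : Submodule A K) ≤ N := by
    rw [Submodule.smul_le]
    intro a ha x _
    exact Submodule.smul_mem_smul ha (hK x.2)
  have := isSemisimpleModule_of_isTorsionBySet hN
  obtain ⟨Y₀, hY₀⟩ := exists_isCompl ((J • (⊤ : Submodule A K)).comap N.subtype)
  let Y : Submodule A K := Y₀.map N.subtype
  have hYN : Y ≤ N := by
    rintro _ ⟨y, _, rfl⟩
    exact y.2
  have hdisj : ∀ y ∈ Y, y ∈ J • (⊤ : Submodule A K) → y = 0 := by
    rintro _ ⟨y, hy, rfl⟩ h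
    rw [Submodule.disjoint_def.mp hY₀.disjoint y h hy, map_zero]
  have hsup : N ≤ J • (⊤ : Submodule A K) ⊔ Y := by
    intro x hx
    obtain ⟨u, hu, v, hv, huv⟩ := Submodule.mem_sup.mp
      ((hY₀.sup_eq_top ▸ Submodule.mem_top : (⟨x, hx⟩ : N) ∈ _ ⊔ Y₀))
    have h1 : (u : K) + v = x := congrArg Subtype.val huv
    rw [← h1]
    exact Submodule.add_mem_sup hu ⟨v, hv, rfl⟩
  have := isSemisimpleModule_of_isTorsionBySet (Module.isTorsionBySet_quotient_ideal_smul K J)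
  obtain ⟨C, hC⟩ := exists_isCompl (Y.map (J • (⊤ : Submodule A K)).mkQ)
  let M : Submodule A K := C.comap (J • (⊤ : Submodule A K)).mkQ
  have hMY : IsCompl M Y := by
    constructor
    · rw [Submodule.disjoint_def]
      intro x hxM hxY
      refine hdisj x hxY ?_
      rw [← Submodule.Quotient.mk_eq_zero]
      exact Submodule.disjoint_def.mp hC.disjoint _ ⟨x, hxY, rfl⟩ hxM
    · rw [codisjoint_iff, eq_top_iff]
      intro x _
      obtain ⟨u, ⟨y, hy, rfl⟩, v, hv, huv⟩ := Submodule.mem_sup.mp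
        ((hC.sup_eq_top ▸ Submodule.mem_top :
          (J • (⊤ : Submodule A K)).mkQ x ∈ Y.map (J • (⊤ : Submodule A K)).mkQ ⊔ C))
      have hxy : x - y ∈ M := by
        change (J • (⊤ : Submodule A K)).mkQ (x - y) ∈ C
        rw [map_sub, ← huv, add_sub_cancel_left]
        exact hv
      rw [← sub_add_cancel x y]
      exact Submodule.add_mem_sup hxy hy
  refine ⟨ModuleCat.of A M, ModuleCat.of A Y, M.subtype, Y.subtype,
    M.projectionOnto Y hMY, Y.projectionOnto M hMY.symm, ?_, ?_, ?_, ?_, ?_⟩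
  · exact LinearMap.ext fun x => Submodule.projectionOnto_apply_left hMY x
  · exact LinearMap.ext fun x => Submodule.projectionOnto_apply_left hMY.symm x
  · exact Submodule.projection_add_projection_eq_id hMY
  · exact hN.of_injective (Submodule.inclusion hYN) (Submodule.inclusion_injective _)
  · intro Z hZ g
    let N' : Submodule A L := (J • L).comap L.subtype
    have hN' : Module.IsTorsionBySet A (L ⧸ N') J :=
      (Module.isTorsionBySet_quotient_iff _ _).mpr fun x a ha => Submodule.smul_mem_smul ha x.2
    have := isSemisimpleModule_of_isTorsionBySet hN'
    let ι : (K ⧸ N) →ₗ[A] (L ⧸ N') := Submodule.mapQ N N' (Submodule.inclusion hK) fun x hx => hx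
    have hι : Function.Injective ι := by
      rw [← LinearMap.ker_eq_bot, Submodule.eq_bot_iff]
      intro x hx
      obtain ⟨y, rfl⟩ := N.mkQ_surjective x
      exact (Submodule.Quotient.mk_eq_zero N).mpr
        ((Submodule.Quotient.mk_eq_zero N').mp hx : Submodule.inclusion hK y ∈ N')
    let g' : (K ⧸ N) →ₗ[A] Z := N.liftQ (g ∘ₗ M.projectionOnto Y hMY) (by
      refine hsup.trans (sup_le (fun x hx => hZ.map_smul_top_eq_zero _ hx) fun x hx => ?_)
      rw [LinearMap.mem_ker, LinearMap.comp_apply,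
        (Submodule.projectionOnto_apply_eq_zero_iff hMY).mpr hx, map_zero])
    obtain ⟨h, hh⟩ := IsSemisimpleModule.extension_property ι hι g'
    refine ⟨h ∘ₗ N'.mkQ, ?_⟩
    ext x
    exact LinearMap.congr_fun hh (N.mkQ x)

end Splitting

namespace ExtLemmas

open Abelian

section General

universe w v u

variable {C : Type u} [Category.{v} C] [Abelian C] [HasExt.{w} C]

theorem subsingleton_of_retract_left {Z W N : C} {n : ℕ} (i : Z ⟶ W) (r : W ⟶ Z) (h : i ≫ r = 𝟙 Z)
    (hW : Subsingleton (Ext W N n)) : Subsingleton (Ext Z N n) :=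
  subsingleton_of_forall_eq 0 fun x => by
    rw [← Ext.mk₀_id_comp x, ← h, ← Ext.mk₀_comp_mk₀_assoc,
      Subsingleton.elim ((Ext.mk₀ r).comp x (zero_add n)) 0, Ext.comp_zero]

theorem subsingleton_of_retract_right {Z W N : C} {n : ℕ} (i : Z ⟶ W) (r : W ⟶ Z) (h : i ≫ r = 𝟙 Z)
    (hW : Subsingleton (Ext N W n)) : Subsingleton (Ext N Z n) :=
  subsingleton_of_forall_eq 0 fun x => by
    rw [← Ext.comp_mk₀_id x, ← h, ← Ext.mk₀_comp_mk₀, ← Ext.comp_assoc_of_third_deg_zero,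
      Subsingleton.elim (x.comp (Ext.mk₀ i) (add_zero n)) 0, Ext.zero_comp]

theorem sum_comp_eq {ι : Type} [Fintype ι] {X U Y : C} {W : ι → C} {d n e : ℕ} (p : ∀ i, X ⟶ W i)
    (q : ∀ i, W i ⟶ X) (h : ∑ i, p i ≫ q i = 𝟙 X) (x : Ext U X d) (y : Ext X Y n) (hn : d + n = e) :
    x.comp y hn = ∑ i, (x.comp (Ext.mk₀ (p i)) (add_zero d)).comp
      ((Ext.mk₀ (q i)).comp y (zero_add n)) hn := by
  conv_lhs => rw [← Ext.comp_mk₀_id x, ← h, Ext.mk₀_sum, Ext.comp_sum, Ext.sum_comp]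
  refine Finset.sum_congr rfl fun i _ => ?_
  rw [Ext.comp_assoc_of_second_deg_zero, Ext.comp_assoc_of_second_deg_zero, Ext.mk₀_comp_mk₀_assoc]

theorem subsingleton_of_sum_left {ι : Type} [Fintype ι] {X N : C} {W : ι → C} {n : ℕ}
    (p : ∀ i, X ⟶ W i) (q : ∀ i, W i ⟶ X) (h : ∑ i, p i ≫ q i = 𝟙 X)
    (hW : ∀ i, Subsingleton (Ext (W i) N n)) : Subsingleton (Ext X N n) :=
  subsingleton_of_forall_eq 0 fun y => by
    rw [← Ext.mk₀_id_comp y, sum_comp_eq p q h]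
    refine Finset.sum_eq_zero fun i _ => ?_
    rw [Subsingleton.elim ((Ext.mk₀ (q i)).comp y (zero_add n)) 0, Ext.comp_zero]

variable {S : ShortComplex C} [Projective S.X₂]

theorem exists_extClass_comp_eq (hS : S.ShortExact) {N : C} {n e : ℕ} (x : Ext S.X₃ N e) (h : 1 + n = e) :
    ∃ y : Ext S.X₁ N n, hS.extClass.comp y h = x := by
  obtain rfl : n + 1 = e := by omega
  exact Ext.contravariant_sequence_exact₃ hS N x (Ext.eq_zero_of_projective _) h

theorem eq_zero_of_extClass_comp_eq_zero (hS : S.ShortExact) {N : C} {n e : ℕ} (y : Ext S.X₁ N (n + 1))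
    (h : 1 + (n + 1) = e) (hy : hS.extClass.comp y h = 0) : y = 0 := by
  obtain ⟨x, rfl⟩ := Ext.contravariant_sequence_exact₁ hS N y h hy
  rw [Ext.eq_zero_of_projective x, Ext.comp_zero]

theorem subsingleton_shift_iff (hS : S.ShortExact) (N : C) (n : ℕ) :
    Subsingleton (Ext S.X₃ N (n + 2)) ↔ Subsingleton (Ext S.X₁ N (n + 1)) := by
  constructor
  · intro h
    exact subsingleton_of_forall_eq 0 fun y =>
      eq_zero_of_extClass_comp_eq_zero hS y (e := n + 2) (by omega) (Subsingleton.elim _ _)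
  · intro h
    refine subsingleton_of_forall_eq 0 fun x => ?_
    obtain ⟨y, rfl⟩ := exists_extClass_comp_eq hS (n := n + 1) x (by omega)
    rw [Subsingleton.elim y 0, Ext.comp_zero]

theorem subsingleton_one_iff (hS : S.ShortExact) (N : C) :
    Subsingleton (Ext S.X₃ N 1) ↔ ∀ f : S.X₁ ⟶ N, ∃ g : S.X₂ ⟶ N, S.f ≫ g = f := by
  constructor
  · intro h f
    obtain ⟨x, hx⟩ := Ext.contravariant_sequence_exact₁ hS N (Ext.mk₀ f) (n₁ := 1) rfl
      (Subsingleton.elim _ _)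
    obtain ⟨g, rfl⟩ := (Ext.mk₀_bijective _ _).2 x
    rw [Ext.mk₀_comp_mk₀] at hx
    exact ⟨g, (Ext.mk₀_bijective _ _).1 hx⟩
  · intro h
    refine subsingleton_of_forall_eq 0 fun x => ?_
    obtain ⟨y, rfl⟩ := exists_extClass_comp_eq hS (n := 0) x rfl
    obtain ⟨f, rfl⟩ := (Ext.mk₀_bijective _ _).2 y
    obtain ⟨g, rfl⟩ := h f
    rw [← Ext.mk₀_comp_mk₀, ShortComplex.ShortExact.extClass_comp_assoc]

end General

theorem subsingleton_zero_iff {C : Type*} [Category C] [Abelian C] [HasExt C] (X Y : C) :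
    Subsingleton (Ext X Y 0) ↔ Subsingleton (X ⟶ Y) :=
  Ext.homEquiv₀.subsingleton_congr

section Modules

variable {A : Type} [Ring A]

theorem exists_shortExact_projective (M : ModuleCat.{0} A) :
    ∃ (P : ModuleCat.{0} A) (f : P →ₗ[A] M), Module.Projective A P ∧ Function.Surjective f :=
  ⟨ModuleCat.of A (M →₀ A), Finsupp.linearCombination A id, inferInstanceAs (Module.Projective A (M →₀ A)),
    Finsupp.linearCombination_id_surjective A M⟩

theorem projective_of {P : ModuleCat.{0} A} (h : Module.Projective A P) : Projective P :=
  (IsProjective.iff_projective P).mp h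

theorem subsingleton_finsupp (κ : Type) (n : ℕ) : ∀ (S N : ModuleCat.{0} A),
    Subsingleton (Ext S N n) → Subsingleton (Ext (ModuleCat.of A (κ →₀ S)) N n) := by
  induction n with
  | zero =>
    intro S N h
    rw [subsingleton_zero_iff] at h ⊢
    refine ⟨fun f g => ?_⟩
    ext1
    refine Finsupp.lhom_ext' fun i => ?_
    exact congrArg ModuleCat.Hom.hom (Subsingleton.elim (ModuleCat.ofHom (f.hom ∘ₗ Finsupp.lsingle i) : S ⟶ N)
      (ModuleCat.ofHom (g.hom ∘ₗ Finsupp.lsingle i)))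
  | succ n ih =>
    intro S N h
    obtain ⟨P, f, hP, hf⟩ := exists_shortExact_projective S
    have hS := LinearMap.shortExact_shortComplexKer hf
    have : Projective f.shortComplexKer.X₂ := projective_of hP
    let T : ShortComplex (ModuleCat.{0} A) := ModuleCat.shortComplexOfCompEqZero
      (Finsupp.mapRange.linearMap (α := κ) (LinearMap.ker f).subtype) (Finsupp.mapRange.linearMap f) (by
        ext i x j
        by_cases hij : i = j <;> simp)
    have hT : T.ShortExact := by
      refine ModuleCat.shortComplex_shortExact T ?_ ?_ ?_
      · intro x
        constructor
        · intro hx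
          have hx' : ∀ i, f (x i) = 0 := fun i => DFunLike.congr_fun hx i
          refine ⟨Finsupp.onFinset x.support (fun i => ⟨x i, hx' i⟩) fun i hi => ?_, ?_⟩
          · rw [Finsupp.mem_support_iff]
            exact fun h0 => hi (Subtype.ext h0)
          · exact Finsupp.ext fun i => rfl
        · rintro ⟨y, rfl⟩
          exact Finsupp.ext fun i => (y i).2
      · exact Finsupp.mapRange_injective _ (map_zero _) (Submodule.injective_subtype _)
      · exact Finsupp.mapRange_surjective _ (map_zero _) hf
    have hTP : Projective T.X₂ := by
      classical
      have : Module.Projective A (Π₀ _ : κ, P) :=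
        inferInstanceAs (Module.Projective A (DirectSum κ fun _ => P))
      exact projective_of (Module.Projective.of_equiv (finsuppLequivDFinsupp (M := P) (ι := κ) A).symm)
    rcases n with _ | n
    · refine (subsingleton_one_iff hT N).mpr fun g => ?_
      have h1 := (subsingleton_one_iff hS N).mp h
      choose u hu using fun i => h1 (ModuleCat.ofHom (g.hom ∘ₗ Finsupp.lsingle i))
      refine ⟨ModuleCat.ofHom (Finsupp.lsum ℕ fun i => (u i).hom), ?_⟩
      ext1
      refine Finsupp.lhom_ext' fun i => ?_
      ext x
      have h2 := LinearMap.congr_fun (congrArg ModuleCat.Hom.hom (hu i)) x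
      refine Eq.trans ?_ h2
      change Finsupp.lsum ℕ (fun i => (u i).hom)
        (Finsupp.mapRange.linearMap (LinearMap.ker f).subtype (Finsupp.single i x)) = (u i).hom x.1
      simp
    · exact (subsingleton_shift_iff hT N n).mpr (ih _ N ((subsingleton_shift_iff hS N n).mp h))

theorem subsingleton_pi (κ : Type) (n : ℕ) : ∀ (N S : ModuleCat.{0} A),
    Subsingleton (Ext N S n) → Subsingleton (Ext N (ModuleCat.of A (κ → S)) n) := by
  induction n with
  | zero =>
    intro N S h
    rw [subsingleton_zero_iff] at h ⊢
    refine ⟨fun f g => ?_⟩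
    ext1
    refine LinearMap.ext fun x => funext fun i => ?_
    exact LinearMap.congr_fun (congrArg ModuleCat.Hom.hom
      (Subsingleton.elim (ModuleCat.ofHom (LinearMap.proj i ∘ₗ f.hom) : N ⟶ S)
        (ModuleCat.ofHom (LinearMap.proj i ∘ₗ g.hom)))) x
  | succ n ih =>
    intro N S h
    obtain ⟨P, f, hP, hf⟩ := exists_shortExact_projective N
    have hS := LinearMap.shortExact_shortComplexKer hf
    have : Projective f.shortComplexKer.X₂ := projective_of hP
    rcases n with _ | n
    · refine (subsingleton_one_iff hS _).mpr fun g => ?_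
      have h1 := (subsingleton_one_iff hS S).mp h
      choose u hu using fun i => h1 (ModuleCat.ofHom (LinearMap.proj i ∘ₗ g.hom))
      refine ⟨ModuleCat.ofHom (LinearMap.pi fun i => (u i).hom), ?_⟩
      ext1
      refine LinearMap.ext fun x => funext fun i => ?_
      exact LinearMap.congr_fun (congrArg ModuleCat.Hom.hom (hu i)) x
    · exact (subsingleton_shift_iff hS _ n).mpr (ih _ S ((subsingleton_shift_iff hS S n).mp h))

variable {J : Ideal A} [J.IsTwoSided] [IsSemisimpleRing (A ⧸ J)]

theorem subsingleton_finsupp_right {N S : ModuleCat.{0} A} (hS : Module.IsTorsionBySet A S J)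
    (κ : Type) {n : ℕ} (h : Subsingleton (Ext N S n)) :
    Subsingleton (Ext N (ModuleCat.of A (κ →₀ S)) n) := by
  have hT : Module.IsTorsionBySet A (κ → S) J := fun x a => funext fun i => @hS (x i) a
  have := isSemisimpleModule_of_isTorsionBySet hT
  obtain ⟨r, hr⟩ := IsSemisimpleModule.extension_property (Finsupp.lcoeFun : (κ →₀ S) →ₗ[A] (κ → S))
    DFunLike.coe_injective LinearMap.id
  exact subsingleton_of_retract_right (W := ModuleCat.of A (κ → S)) (ModuleCat.ofHom Finsupp.lcoeFun)
    (ModuleCat.ofHom r) (by ext1; exact hr) (subsingleton_pi κ n N S h)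

end Modules

end ExtLemmas

section Steps

open Abelian ExtLemmas

variable {A : Type} [Ring A]

/-- The largest quotient of `M` annihilated by `J`. -/
def topQuotient (J : Ideal A) (M : ModuleCat.{0} A) : ModuleCat.{0} A :=
  ModuleCat.of A (M ⧸ (J • ⊤ : Submodule A M))

/-- The projection of `M` onto `M / J M`. -/
def toTopQuotient (J : Ideal A) (M : ModuleCat.{0} A) : M ⟶ topQuotient J M :=
  ModuleCat.ofHom (J • ⊤ : Submodule A M).mkQ

theorem isTorsionBySet_topQuotient (J : Ideal A) (M : ModuleCat.{0} A) :
    Module.IsTorsionBySet A (topQuotient J M) J :=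
  Module.isTorsionBySet_quotient_ideal_smul M J

/-- Precomposition with `δ` is injective on `Ext` groups with values in modules annihilated
by `J`. -/
def InjectiveOnTorsion (J : Ideal A) {M N : ModuleCat.{0} A} (δ : Ext M N 1) : Prop :=
  ∀ (Z : ModuleCat.{0} A), Module.IsTorsionBySet A Z J → ∀ (n e : ℕ) (h : 1 + n = e) (g : Ext N Z n),
    δ.comp g h = 0 → g = 0

/-- The properties of a decomposition `M' ⊕ Y` of the first syzygy of `M` that are used below. -/
structure IsStep (J : Ideal A) (M M' Y : ModuleCat.{0} A) : Prop where
  torsion : Module.IsTorsionBySet A Y J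
  exists_left : ∃ δ : Ext M M' 1, InjectiveOnTorsion J δ ∧
    ∃ η : Ext (topQuotient J M) (topQuotient J M') 1,
      δ.comp (Ext.mk₀ (toTopQuotient J M')) (add_zero 1) =
        (Ext.mk₀ (toTopQuotient J M)).comp η (zero_add 1)
  exists_right : ∃ δ : Ext M Y 1, InjectiveOnTorsion J δ
  subsingleton : ∀ (N : ModuleCat.{0} A) (n : ℕ), Subsingleton (Ext M' N n) →
    Subsingleton (Ext Y N n) → Subsingleton (Ext M N (n + 1))

theorem exists_isStep {J : Ideal A} [J.IsTwoSided] [IsSemisimpleRing (A ⧸ J)] (h3 : CubeZero J)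
    (M : ModuleCat.{0} A) : ∃ M' Y : ModuleCat.{0} A, IsStep J M M' Y := by
  obtain ⟨P, f, hP, hf, hK⟩ := exists_projectiveCover h3 M
  obtain ⟨M', Y, i, j, r, t, hri, htj, hsum, hY, hext⟩ :=
    exists_torsion_splitting h3 (LinearMap.ker f) hK
  let L : Submodule A P := J • ⊤
  have hS := LinearMap.shortExact_shortComplexKer hf
  have : Projective f.shortComplexKer.X₂ := projective_of hP
  have hir : ModuleCat.ofHom i ≫ ModuleCat.ofHom r = 𝟙 M' := by ext1; exact hri
  have hjt : ModuleCat.ofHom j ≫ ModuleCat.ofHom t = 𝟙 Y := by ext1; exact htj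
  have hinj : ∀ (Z : ModuleCat.{0} A), Module.IsTorsionBySet A Z J → ∀ (n e : ℕ) (h : 1 + n = e)
      (g : Ext f.shortComplexKer.X₁ Z n), hS.extClass.comp g h = 0 → g = 0 := by
    intro Z hZ n e h g hg
    rcases n with _ | n
    · obtain ⟨x, rfl⟩ := Ext.contravariant_sequence_exact₁ hS Z g h hg
      obtain ⟨u, rfl⟩ := (Ext.mk₀_bijective _ _).2 x
      rw [Ext.mk₀_comp_mk₀, Ext.mk₀_eq_zero_iff]
      ext1
      exact LinearMap.ext fun x => hZ.map_smul_top_eq_zero u.hom (hK x.2)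
    · exact eq_zero_of_extClass_comp_eq_zero hS g h hg
  have hinj' : ∀ (W : ModuleCat.{0} A) (a : W ⟶ f.shortComplexKer.X₁) (b : f.shortComplexKer.X₁ ⟶ W),
      a ≫ b = 𝟙 W → InjectiveOnTorsion J (hS.extClass.comp (Ext.mk₀ b) (add_zero 1)) := by
    intro W a b hab Z hZ n e h g hg
    rw [Ext.comp_assoc_of_second_deg_zero] at hg
    have h1 := hinj Z hZ n e h _ hg
    rw [← Ext.mk₀_id_comp g, ← hab, ← Ext.mk₀_comp_mk₀_assoc, h1, Ext.comp_zero]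
  refine ⟨M', Y, hY, ⟨hS.extClass.comp (Ext.mk₀ (ModuleCat.ofHom r)) (add_zero 1),
    hinj' M' (ModuleCat.ofHom i) _ hir, ?_⟩,
    ⟨_, hinj' Y (ModuleCat.ofHom j) (ModuleCat.ofHom t) hjt⟩, ?_⟩
  · obtain ⟨g, hg⟩ := hext _ (isTorsionBySet_topQuotient J M') (toTopQuotient J M').hom
    have hcomp : L = LinearMap.ker ((toTopQuotient J M).hom ∘ₗ f) := by
      apply le_antisymm
      · exact fun x hx => (isTorsionBySet_topQuotient J M).map_smul_top_eq_zero _ hx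
      · intro x hx
        have h1 : f x ∈ J • (⊤ : Submodule A M) := (Submodule.Quotient.mk_eq_zero _).mp hx
        rw [← LinearMap.range_eq_top.mpr hf, LinearMap.range_eq_map, ← Submodule.map_smul''] at h1
        obtain ⟨y, hy, hyx⟩ := h1
        have h2 : x - y ∈ LinearMap.ker f := by rw [LinearMap.mem_ker, map_sub, hyx, sub_self]
        rw [← sub_add_cancel x y]
        exact add_mem (hK h2) hy
    let T : ShortComplex (ModuleCat.{0} A) := ModuleCat.shortComplexOfCompEqZero L.subtype
      ((toTopQuotient J M).hom ∘ₗ f) (by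
        ext x
        exact (hcomp.le x.2 : x.1 ∈ LinearMap.ker ((toTopQuotient J M).hom ∘ₗ f)))
    have hT : T.ShortExact := by
      refine ModuleCat.shortComplex_shortExact T ?_ (Submodule.injective_subtype _)
        ((Submodule.mkQ_surjective _).comp hf)
      intro x
      constructor
      · exact fun hx => ⟨⟨x, hcomp.ge hx⟩, rfl⟩
      · rintro ⟨y, rfl⟩
        exact hcomp.le y.2
    let φ : f.shortComplexKer ⟶ T :=
      { τ₁ := ModuleCat.ofHom (Submodule.inclusion hK)
        τ₂ := 𝟙 P
        τ₃ := toTopQuotient J M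
        comm₁₂ := rfl
        comm₂₃ := rfl }
    refine ⟨hT.extClass.comp (Ext.mk₀ (ModuleCat.ofHom g)) (add_zero 1), ?_⟩
    have hφ : ModuleCat.ofHom r ≫ toTopQuotient J M' = φ.τ₁ ≫ ModuleCat.ofHom g := by
      ext1
      exact hg.symm
    rw [Ext.comp_assoc_of_third_deg_zero, Ext.mk₀_comp_mk₀, hφ, ← Ext.mk₀_comp_mk₀,
      ← Ext.comp_assoc_of_third_deg_zero, ShortComplex.ShortExact.extClass_naturality hS hT φ,
      Ext.comp_assoc_of_third_deg_zero]
  · intro N n h1 h2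
    refine subsingleton_of_forall_eq 0 fun x => ?_
    obtain ⟨y, rfl⟩ := exists_extClass_comp_eq hS (n := n) x (by omega)
    have hid : ModuleCat.ofHom r ≫ ModuleCat.ofHom i + ModuleCat.ofHom t ≫ ModuleCat.ofHom j =
        𝟙 f.shortComplexKer.X₁ := by
      ext1
      exact hsum
    rw [← Ext.mk₀_id_comp y, ← hid, Ext.mk₀_add, Ext.add_comp, ← Ext.mk₀_comp_mk₀_assoc,
      ← Ext.mk₀_comp_mk₀_assoc, Subsingleton.elim ((Ext.mk₀ (ModuleCat.ofHom i)).comp y _) 0,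
      Subsingleton.elim ((Ext.mk₀ (ModuleCat.ofHom j)).comp y _) 0, Ext.comp_zero, Ext.comp_zero,
      add_zero, Ext.comp_zero]

end Steps

section Chains

open Abelian ExtLemmas

variable {A : Type} [Ring A]

/-- The class `x` is a product whose first `k` factors are extensions of modules annihilated
by `J`. -/
def IsExtChain (J : Ideal A) {Y : ModuleCat.{0} A} :
    (k : ℕ) → {X : ModuleCat.{0} A} → {n : ℕ} → Ext X Y n → Prop
  | 0, _, _, _ => True
  | k + 1, X, n, x => ∃ (Z : ModuleCat.{0} A) (n' : ℕ) (h : 1 + n' = n) (η : Ext X Z 1) (y : Ext Z Y n'),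
      Module.IsTorsionBySet A Z J ∧ x = η.comp y h ∧ IsExtChain J k y

theorem IsExtChain.exists_eq_comp {J : Ideal A} {Y : ModuleCat.{0} A} (a k : ℕ) :
    ∀ {X : ModuleCat.{0} A} {n : ℕ} {x : Ext X Y n}, Module.IsTorsionBySet A X J →
      IsExtChain J (a + k) x →
      ∃ (Z : ModuleCat.{0} A) (n' : ℕ) (h : a + n' = n) (θ : Ext X Z a) (z : Ext Z Y n'),
        Module.IsTorsionBySet A Z J ∧ x = θ.comp z h ∧ IsExtChain J k z := by
  induction a with
  | zero =>
    intro X n x hX hx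
    rw [zero_add] at hx
    exact ⟨X, n, zero_add n, Ext.mk₀ (𝟙 X), x, hX, (Ext.mk₀_id_comp x).symm, hx⟩
  | succ a ih =>
    intro X n x hX hx
    rw [show a + 1 + k = (a + k) + 1 by omega] at hx
    obtain ⟨W, n₁, h₁, η, y, hW, rfl, hy⟩ := hx
    obtain ⟨Z, n', h', θ, z, hZ, rfl, hz⟩ := ih hW hy
    refine ⟨Z, n', by omega, η.comp θ (add_comm 1 a), z, hZ, ?_, hz⟩
    exact (Ext.comp_assoc η θ z _ h' (by omega)).symm

variable {J : Ideal A} [J.IsTwoSided] [IsSemisimpleRing (A ⧸ J)]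
  {ι : Type} [Fintype ι] {S : ι → ModuleCat.{0} A}

/-- A module annihilated by `J` is a finite sum of isotypic modules. -/
theorem exists_isotypic_sum_eq_id (hS : IsCompleteSimpleFamily S) {X : ModuleCat.{0} A}
    (hX : Module.IsTorsionBySet A X J) :
    ∃ (κ : ι → Type) (p : ∀ i, X ⟶ ModuleCat.of A (κ i →₀ S i)) (q : ∀ i, ModuleCat.of A (κ i →₀ S i) ⟶ X),
      (∀ i, Function.Injective (q i).hom) ∧ ∑ i, p i ≫ q i = 𝟙 X := by
  obtain ⟨κ, p, q, hq, hpq⟩ := exists_isotypic_decomposition hS hX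
  refine ⟨κ, fun i => ModuleCat.ofHom (p i), fun i => ModuleCat.ofHom (q i), hq, ?_⟩
  ext1
  rw [ModuleCat.hom_sum]
  exact hpq

theorem comp_eq_zero_of_isExtChain (h3 : CubeZero J) (hS : IsCompleteSimpleFamily S) {m : ℕ}
    (hvan : ∀ i n, m ≤ n → Subsingleton (Ext (S i) (S i) n)) (F : Finset ι) {U X Y : ModuleCat.{0} A}
    (hX : Module.IsTorsionBySet A X J) {d n e : ℕ} (h : d + n = e) (w : Ext U X d)
    (hw : ∀ i ∉ F, ∀ (κ : Type) (a b : ℕ) (hab : d + a = b) (y : Ext X (ModuleCat.of A (κ →₀ S i)) a),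
      w.comp y hab = 0) (x : Ext X Y n) (hx : IsExtChain J (m * F.card) x) : w.comp x h = 0 := by
  classical
  induction hk : F.card generalizing F X d n with
  | zero =>
    obtain ⟨κ, p, q, -, hpq⟩ := exists_isotypic_sum_eq_id hS hX
    rw [sum_comp_eq p q hpq]
    refine Finset.sum_eq_zero fun i _ => ?_
    rw [hw i (by simp [Finset.card_eq_zero.mp hk]), Ext.zero_comp]
  | succ k ih =>
    obtain ⟨κ, p, q, -, hpq⟩ := exists_isotypic_sum_eq_id hS hX
    rw [sum_comp_eq p q hpq]
    refine Finset.sum_eq_zero fun i _ => ?_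
    by_cases hi : i ∈ F
    swap
    · rw [hw i hi, Ext.zero_comp]
    have hcard : (F.erase i).card = k := by rw [Finset.card_erase_of_mem hi, hk, Nat.add_sub_cancel]
    rw [hk, mul_add, mul_one, add_comm] at hx
    obtain ⟨Z, n', h', θ, z, hZ, rfl, hz⟩ := hx.exists_eq_comp m (m * k) hX
    rw [← Ext.comp_assoc (Ext.mk₀ (q i)) θ z (zero_add m) h' (by omega),
      ← Ext.comp_assoc (w.comp (Ext.mk₀ (p i)) (add_zero d)) ((Ext.mk₀ (q i)).comp θ (zero_add m)) z
        rfl h' (by omega)]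
    refine ih (F.erase i) hZ _ _ ?_ z (by rwa [hcard]) hcard
    intro j hj κ' a b hab y
    rw [Ext.comp_assoc (w.comp (Ext.mk₀ (p i)) (add_zero d)) ((Ext.mk₀ (q i)).comp θ (zero_add m)) y
        rfl rfl (by omega)]
    by_cases hji : j = i
    · subst hji
      have hsimple := hS.isSimple j
      have hSt : Module.IsTorsionBySet A (S j) J := isTorsionBySet_of_isSimpleModule h3
      have := subsingleton_finsupp_right hSt κ'
        (subsingleton_finsupp (κ j) (m + a) (S j) (S j) (hvan j (m + a) (Nat.le_add_right m a)))
      rw [Subsingleton.elim ((((Ext.mk₀ (q j)).comp θ (zero_add m))).comp y rfl) 0, Ext.comp_zero]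
    · rw [Ext.comp_assoc_of_second_deg_zero]
      exact hw j (fun hjF => hj (Finset.mem_erase.mpr ⟨hji, hjF⟩)) _ _ _ _ _

theorem eq_zero_of_isExtChain (h3 : CubeZero J) (hS : IsCompleteSimpleFamily S) {m : ℕ}
    (hvan : ∀ i n, m ≤ n → Subsingleton (Ext (S i) (S i) n)) {X Y : ModuleCat.{0} A}
    (hX : Module.IsTorsionBySet A X J) {n : ℕ} (x : Ext X Y n)
    (hx : IsExtChain J (m * Fintype.card ι) x) : x = 0 := by
  rw [← Ext.mk₀_id_comp x]
  exact comp_eq_zero_of_isExtChain h3 hS hvan Finset.univ hX _ _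
    (fun i hi => absurd (Finset.mem_univ i) hi) x hx

/-- Iterating `IsStep` at most `n` times starting from `M` can lead to the zero module. -/
def IsStepResolvable (J : Ideal A) : ℕ → ModuleCat.{0} A → Prop
  | 0, M => Subsingleton M
  | n + 1, M => ∃ M' Y, IsStep J M M' Y ∧ IsStepResolvable J n M'

theorem isStepResolvable_or_exists_isExtChain (h3 : CubeZero J) (n : ℕ) : ∀ M : ModuleCat.{0} A,
    IsStepResolvable J n M ∨ ∃ (Y : ModuleCat.{0} A) (x : Ext (topQuotient J M) Y n),
      IsExtChain J n x ∧ Module.IsTorsionBySet A Y J ∧ (Ext.mk₀ (toTopQuotient J M)).comp x (zero_add n) ≠ 0 := by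
  induction n with
  | zero =>
    intro M
    refine or_iff_not_imp_right.mpr fun h => ?_
    by_contra hM
    refine h ⟨topQuotient J M, Ext.mk₀ (𝟙 _), trivial, isTorsionBySet_topQuotient J M, fun h0 => hM ?_⟩
    rw [Ext.comp_mk₀_id, Ext.mk₀_eq_zero_iff] at h0
    have h1 : (J • ⊤ : Submodule A M) = ⊤ := by
      rw [← Submodule.ker_mkQ (J • ⊤ : Submodule A M)]
      exact LinearMap.ker_eq_top.mpr (congrArg ModuleCat.Hom.hom h0)
    have h2 : (⊥ : Submodule A M) = ⊤ := nakayama h3 (by rw [h1, bot_sup_eq])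
    exact (Submodule.subsingleton_iff A).mp (subsingleton_of_bot_eq_top h2)
  | succ n ih =>
    intro M
    obtain ⟨M', Y', hstep⟩ := exists_isStep h3 M
    rcases ih M' with h | ⟨Y, x, hx, hY, hne⟩
    · exact Or.inl ⟨M', Y', hstep, h⟩
    · right
      obtain ⟨δ, hδ, η, hη⟩ := hstep.exists_left
      refine ⟨Y, η.comp x (add_comm 1 n), ⟨_, n, _, η, x, isTorsionBySet_topQuotient J M', rfl, hx⟩, hY, ?_⟩
      rw [← Ext.comp_assoc (Ext.mk₀ (toTopQuotient J M)) η x (zero_add 1) (add_comm 1 n) (by omega), ← hη,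
        Ext.comp_assoc_of_second_deg_zero]
      exact fun h0 => hne (hδ Y hY n _ _ _ h0)

theorem isStepResolvable (h3 : CubeZero J) (hS : IsCompleteSimpleFamily S) {m : ℕ}
    (hvan : ∀ i n, m ≤ n → Subsingleton (Ext (S i) (S i) n)) (M : ModuleCat.{0} A) :
    IsStepResolvable J (m * Fintype.card ι) M := by
  refine (isStepResolvable_or_exists_isExtChain h3 _ M).resolve_right ?_
  rintro ⟨Y, x, hx, -, hne⟩
  rw [eq_zero_of_isExtChain h3 hS hvan (isTorsionBySet_topQuotient J M) x hx, Ext.comp_zero] at hne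
  exact hne rfl

end Chains

section ProjectiveDimension

open Abelian ExtLemmas

variable {A : Type} [Ring A]

theorem projDimLE_mono {M : ModuleCat.{0} A} {a b : ℕ} (hab : a ≤ b) (h : projDimLE A M a) :
    projDimLE A M b :=
  fun N k hk => h N k (hab.trans_lt hk)

theorem subsingleton_ext_of_subsingleton {M : ModuleCat.{0} A} (h : Subsingleton M) (N : ModuleCat.{0} A)
    (n : ℕ) : Subsingleton (Ext M N n) :=
  subsingleton_of_forall_eq 0 fun x => by
    have h0 : 𝟙 M = 0 := by
      ext y
      exact Subsingleton.elim _ _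
    rw [← Ext.mk₀_id_comp x, h0, Ext.mk₀_zero, Ext.zero_comp]

theorem projDimLE_of_submodule {M : ModuleCat.{0} A} (K : Submodule A M) {d : ℕ}
    (hK : projDimLE A (ModuleCat.of A K) d) (hQ : projDimLE A (ModuleCat.of A (M ⧸ K)) d) :
    projDimLE A M d := by
  intro N k hk
  let T : ShortComplex (ModuleCat.{0} A) := ModuleCat.shortComplexOfCompEqZero K.subtype K.mkQ (by
    ext x
    exact (Submodule.Quotient.mk_eq_zero K).mpr x.2)
  have hT : T.ShortExact := by
    refine ModuleCat.shortComplex_shortExact T ?_ K.injective_subtype K.mkQ_surjective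
    exact LinearMap.exact_subtype_mkQ K
  have h1 : Subsingleton (Ext T.X₁ N k) := hK N k hk
  have h2 : Subsingleton (Ext T.X₃ N k) := hQ N k hk
  refine subsingleton_of_forall_eq 0 fun x => ?_
  obtain ⟨y, rfl⟩ := Ext.contravariant_sequence_exact₂ hT N x (Subsingleton.elim _ _)
  rw [Subsingleton.elim y 0, Ext.comp_zero]

/-- Vanishing of `Ext` from `M` into modules annihilated by `J` implies vanishing of `Ext` from `N`
in degrees lowered by `n`. -/
def LowersVanishing (J : Ideal A) (n : ℕ) (M N : ModuleCat.{0} A) : Prop :=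
  ∀ Z : ModuleCat.{0} A, Module.IsTorsionBySet A Z J → ∀ k : ℕ, Subsingleton (Ext M Z (k + n)) →
    Subsingleton (Ext N Z k)

theorem LowersVanishing.trans {J : Ideal A} {a b : ℕ} {M N P : ModuleCat.{0} A}
    (h : LowersVanishing J a M N) (h' : LowersVanishing J b N P) : LowersVanishing J (a + b) M P := by
  intro Z hZ k hk
  rw [show k + (a + b) = (k + b) + a by omega] at hk
  exact h' Z hZ k (h Z hZ (k + b) hk)

theorem LowersVanishing.of_injectiveOnTorsion {J : Ideal A} {M N : ModuleCat.{0} A} {δ : Ext M N 1}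
    (h : InjectiveOnTorsion J δ) : LowersVanishing J 1 M N := by
  intro Z hZ k hk
  exact subsingleton_of_forall_eq 0 fun g => h Z hZ k (k + 1) (add_comm 1 k) g (Subsingleton.elim _ _)

theorem LowersVanishing.of_retract {J : Ideal A} {M N : ModuleCat.{0} A} (i : N ⟶ M) (r : M ⟶ N)
    (h : i ≫ r = 𝟙 N) : LowersVanishing J 0 M N :=
  fun _ _ _ hk => subsingleton_of_retract_left i r h hk

theorem not_lowersVanishing_self {J : Ideal A} {m : ℕ} {S : ModuleCat.{0} A}
    (hSJ : Module.IsTorsionBySet A S J) (hS : Nontrivial S)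
    (hvan : ∀ n, m ≤ n → Subsingleton (Ext S S n)) {n : ℕ} (hn : 1 ≤ n) : ¬ LowersVanishing J n S S := by
  intro h
  have hiter : ∀ j : ℕ, LowersVanishing J (n * j) S S := fun j => by
    induction j with
    | zero => exact LowersVanishing.of_retract (𝟙 S) (𝟙 S) (Category.comp_id _)
    | succ j ih => exact ih.trans h
  have h0 : Subsingleton (Ext S S 0) := hiter m S hSJ 0 (hvan _ (by nlinarith))
  rw [subsingleton_zero_iff] at h0
  obtain ⟨x, hx⟩ := exists_ne (0 : S)
  exact hx (LinearMap.congr_fun (congrArg ModuleCat.Hom.hom (Subsingleton.elim (𝟙 S) 0)) x)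

variable {J : Ideal A} [J.IsTwoSided] [IsSemisimpleRing (A ⧸ J)]
  {ι : Type} [Fintype ι] {S : ι → ModuleCat.{0} A}

theorem projDimLE_of_isTorsionBySet (hS : IsCompleteSimpleFamily S) {Y : ModuleCat.{0} A}
    (hY : Module.IsTorsionBySet A Y J) {d : ℕ}
    (h : ∀ i, (∃ (a : S i ⟶ Y) (b : Y ⟶ S i), a ≫ b = 𝟙 (S i)) → projDimLE A (S i) d) :
    projDimLE A Y d := by
  intro N k hk
  obtain ⟨κ, p, q, hq, hpq⟩ := exists_isotypic_sum_eq_id hS hY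
  refine subsingleton_of_sum_left p q hpq fun i => ?_
  rcases isEmpty_or_nonempty (κ i) with hκ | ⟨⟨c⟩⟩
  · exact subsingleton_ext_of_subsingleton (inferInstanceAs (Subsingleton (κ i →₀ S i))) N k
  · have := isSemisimpleModule_of_isTorsionBySet hY
    obtain ⟨b, hb⟩ := IsSemisimpleModule.extension_property ((q i).hom ∘ₗ Finsupp.lsingle c)
      ((hq i).comp (Finsupp.single_injective c)) LinearMap.id
    refine subsingleton_finsupp (κ i) k (S i) N
      (h i ⟨ModuleCat.ofHom ((q i).hom ∘ₗ Finsupp.lsingle c), ModuleCat.ofHom b, ?_⟩ N k hk)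
    ext1
    exact hb

theorem IsStepResolvable.projDimLE (hS : IsCompleteSimpleFamily S) {T : ModuleCat.{0} A} {d : ℕ}
    (hd : ∀ i, (∃ c, 1 ≤ c ∧ LowersVanishing J c T (S i)) → projDimLE A (S i) d) {n : ℕ} :
    ∀ {M : ModuleCat.{0} A} {a : ℕ}, LowersVanishing J a T M → IsStepResolvable J n M →
      projDimLE A M (d + n) := by
  induction n with
  | zero => exact fun _ hM N k _ => subsingleton_ext_of_subsingleton hM N k
  | succ n ih =>
    rintro M a hTM ⟨M', Y, hstep, hM'⟩ N k hk
    obtain ⟨k, rfl⟩ : ∃ k', k = k' + 1 := ⟨k - 1, by omega⟩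
    obtain ⟨δ, hδ, -⟩ := hstep.exists_left
    obtain ⟨δ', hδ'⟩ := hstep.exists_right
    refine hstep.subsingleton N k
      (ih (hTM.trans (.of_injectiveOnTorsion hδ)) hM' N k (by omega))
      (projDimLE_of_isTorsionBySet hS hstep.torsion (d := d) ?_ N k (by omega))
    rintro i ⟨u, v, huv⟩
    exact hd i ⟨a + 1 + 0, by omega,
      (hTM.trans (.of_injectiveOnTorsion hδ')).trans (.of_retract u v huv)⟩

theorem exists_projDimLE_of_simple (h3 : CubeZero J) (hS : IsCompleteSimpleFamily S) {m : ℕ}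
    (hvan : ∀ i n, m ≤ n → Subsingleton (Ext (S i) (S i) n)) (j : ι) : ∃ d, projDimLE A (S j) d := by
  let r : ι → ι → Prop := fun i j => ∃ c, 1 ≤ c ∧ LowersVanishing J c (S j) (S i)
  have : IsTrans ι r := ⟨by
    rintro i j k ⟨a, ha, hij⟩ ⟨b, -, hjk⟩
    exact ⟨b + a, by omega, hjk.trans hij⟩⟩
  have : Std.Irrefl r := ⟨by
    rintro i ⟨c, hc, h⟩
    have := hS.isSimple i
    exact not_lowersVanishing_self (isTorsionBySet_of_isSimpleModule h3)
      (IsSimpleModule.nontrivial A (S i)) (hvan i) hc h⟩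
  induction j using (Finite.wellFounded_of_trans_of_irrefl r).induction with
  | _ j ih =>
    choose! f hf using ih
    refine ⟨_, IsStepResolvable.projDimLE hS (T := S j) (d := Finset.univ.sup f) (fun i hi => ?_)
      (.of_retract (𝟙 _) (𝟙 _) (Category.comp_id _)) (isStepResolvable h3 hS hvan (S j))⟩
    exact projDimLE_mono (Finset.le_sup (Finset.mem_univ i)) (hf i hi)

theorem exists_forall_projDimLE (h3 : CubeZero J) (hS : IsCompleteSimpleFamily S) {m : ℕ}
    (hvan : ∀ i n, m ≤ n → Subsingleton (Ext (S i) (S i) n)) :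
    ∃ d, ∀ M : ModuleCat.{0} A, projDimLE A M d := by
  choose f hf using exists_projDimLE_of_simple h3 hS hvan
  have htors : ∀ Y : ModuleCat.{0} A, Module.IsTorsionBySet A Y J → projDimLE A Y (Finset.univ.sup f) :=
    fun Y hY => projDimLE_of_isTorsionBySet hS hY fun i _ =>
      projDimLE_mono (Finset.le_sup (Finset.mem_univ i)) (hf i)
  refine ⟨Finset.univ.sup f, fun M => ?_⟩
  let K : Submodule A M := J • ⊤
  have hcube : J • (J • K) = ⊥ := smul_cube h3 ⊤
  refine projDimLE_of_submodule K ?_ (htors _ (isTorsionBySet_topQuotient J M))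
  refine projDimLE_of_submodule (M := ModuleCat.of A K) ((J • K).submoduleOf K) (htors _ ?_) (htors _ ?_)
  · rintro ⟨x, hx⟩ a
    refine Subtype.ext (Subtype.ext ?_)
    exact (Submodule.mem_bot A).mp (hcube.le (Submodule.smul_mem_smul a.2 hx))
  · intro x a
    obtain ⟨x, rfl⟩ := Submodule.Quotient.mk_surjective _ x
    exact (Submodule.Quotient.mk_eq_zero _).mpr (Submodule.smul_mem_smul a.2 x.2)

end ProjectiveDimension

/-- If `A/J` is semisimple, `J³ = 0` and there is `m > 0` with `Ext^n(S, S) = 0`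
for all simple `S` and all `n ≥ m`, then `A` has finite global dimension. -/
theorem stmt_13 (A : Type) [Ring A] (hss : SemisimpleModJ A) (h3 : JCubeZero A)
    (hvan : ∃ m : ℕ, 0 < m ∧ ExtSelfVanishes A m) :
    globalDim A ≠ ⊤ := by
  obtain ⟨m, -, hm⟩ := hvan
  have := isSemisimpleRing_quotient_jrad hss
  have hcube : CubeZero (jrad A).asIdeal := fun x hx y hy z hz => h3 x y z
    (TwoSidedIdeal.mem_asIdeal.mp hx) (TwoSidedIdeal.mem_asIdeal.mp hy) (TwoSidedIdeal.mem_asIdeal.mp hz)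
  obtain ⟨_, S, hS⟩ := exists_isCompleteSimpleFamily hcube
  obtain ⟨d, hd⟩ := exists_forall_projDimLE hcube hS fun i => hm (S i) (hS.isSimple i)
  have hle : globalDim A ≤ d := iSup_le fun M => sInf_le ⟨d, rfl, hd M⟩
  exact ne_top_of_le_ne_top (ENat.natCast_ne_top d) hle

end
end
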